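/- arXiv:cs/0201001 — 10 statements merged into one kernel-verified Lean document; each statement's English description precedes it below -/
import Mathlib

section
/- There exists a constant C > 0 such that for every n ≥ 1, every bilinear computation of n×n matrix product over GF(2) has length m ≥ 3n² − C·n^(5/3). Equivalently, the bilinear rank of n×n matrix product over GF(2) is at least 3n² − O(n^(5/3)). -/
open Finset in
/-- A polynomial over `ZMod 2` that does not vanish identically as a function is nonzero at some
point whose support has at most `totalDegree` elements. -/
theorem MvPolynomial.exists_eval_ne_zero_card_support_le {ι : Type*} [Fintype ι] [DecidableEq ι]
    (p : MvPolynomial ι (ZMod 2)) (v : ι → ZMod 2) (hv : eval v p ≠ 0) :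
    ∃ u : ι → ZMod 2, eval u p ≠ 0 ∧ #{i | u i ≠ 0} ≤ p.totalDegree := by
  obtain ⟨u, hu, hmin⟩ := exists_min_image ({x | eval x p ≠ 0} : Finset (ι → ZMod 2))
    (fun x => #{i | x i ≠ 0}) ⟨v, by simpa using hv⟩
  simp only [mem_filter, mem_univ, true_and] at hu hmin
  refine ⟨u, hu, ?_⟩
  by_contra! hlt
  set q : MvPolynomial ι (ZMod 2) := p * ∏ i with u i = 0, (1 - X i) with hq
  have hdeg : q.totalDegree < (Fintype.card (ZMod 2) - 1) * Fintype.card ι := by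
    have h1 : (∏ i with u i = 0, (1 - X i : MvPolynomial ι (ZMod 2))).totalDegree
        ≤ #{i | u i = 0} := by
      refine (totalDegree_finsetProd _ _).trans ?_
      rw [card_eq_sum_ones]
      refine sum_le_sum fun i _ => (totalDegree_sub _ _).trans ?_
      simp [totalDegree_X]
    have h2 : q.totalDegree ≤ _ := totalDegree_mul p _
    have h3 := card_filter_add_card_filter_not (s := (univ : Finset ι)) (fun i => u i = 0)
    rw [card_univ] at h3
    rw [ZMod.card]
    simp only [ne_eq] at hlt
    omega
  have hsum := sum_eval_eq_zero q hdeg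
  rw [sum_eq_single u] at hsum
  · refine hu ?_
    have : ∏ i with u i = 0, (1 - u i) = 1 := prod_eq_one fun i hi => by simp_all
    simpa [hq, eval_prod, this] using hsum
  · intro x _ hxu
    by_contra hx
    simp only [hq, map_mul, eval_prod, map_sub, map_one, eval_X, mul_eq_zero, not_or] at hx
    obtain ⟨hxp, hx⟩ := hx
    rw [← ne_eq, prod_ne_zero_iff] at hx
    have hx0 : ∀ i, u i = 0 → x i = 0 := fun i hi => by
      have := hx i (by simp [hi])
      generalize x i = a at this
      revert a
      decide
    have hsub : ({i | x i ≠ 0} : Finset ι) ⊆ ({i | u i ≠ 0} : Finset ι) := fun i => by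
      simpa using mt (hx0 i)
    have heq := eq_of_subset_of_card_le hsub (hmin x hxp)
    apply hxu
    funext i
    have hi : x i ≠ 0 ↔ u i ≠ 0 := by simpa using congrArg (i ∈ ·) heq
    generalize x i = a at hi
    generalize u i = b at hi
    revert a b
    decide
  · simp

/-- For `k ≤ n` there are `k` matrices over `ZMod 2` all of whose nontrivial linear combinations
are invertible. -/
theorem Matrix.exists_forall_det_sum_smul_ne_zero {n k : ℕ} (hn : n ≠ 0) (hk : k ≤ n) :
    ∃ A : Fin k → Matrix (Fin n) (Fin n) (ZMod 2),
      ∀ c : Fin k → ZMod 2, c ≠ 0 → (∑ i, c i • A i).det ≠ 0 := by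
  let b := Module.finBasisOfFinrankEq (ZMod 2) (GaloisField 2 n) (GaloisField.finrank 2 hn)
  refine ⟨fun i => Algebra.leftMulMatrix b (b (Fin.castLE hk i)), fun c hc => ?_⟩
  have hli : LinearIndependent (ZMod 2) fun i => b (Fin.castLE hk i) :=
    b.linearIndependent.comp _ (Fin.castLE_injective hk)
  have hx : ∑ i, c i • b (Fin.castLE hk i) ≠ 0 := fun h =>
    hc (funext (Fintype.linearIndependent_iff.mp hli c h))
  have hu := ((isUnit_iff_ne_zero.mpr hx).map (Algebra.leftMulMatrix b))
  simpa [map_sum, map_smul] using ((Matrix.isUnit_iff_isUnit_det _).mp hu).ne_zero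

/-- The determinant of a matrix of polynomials of degree at most one has degree at most `n`. -/
theorem Matrix.totalDegree_det_le {σ R : Type*} [CommRing R] {n : ℕ}
    (M : Matrix (Fin n) (Fin n) (MvPolynomial σ R)) (hM : ∀ i j, (M i j).totalDegree ≤ 1) :
    M.det.totalDegree ≤ n := by
  rw [Matrix.det_apply]
  refine MvPolynomial.totalDegree_finsetSum_le fun τ _ => ?_
  refine (MvPolynomial.totalDegree_smul_le _ _).trans ?_
  refine (MvPolynomial.totalDegree_finsetProd _ _).trans ?_
  exact (Finset.sum_le_sum fun i _ => hM _ _).trans (by simp)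

open Finset in
/-- Relative to any coordinate system on matrices, there are `k` matrices supported on few common
coordinates all of whose nontrivial linear combinations are invertible. -/
theorem Matrix.exists_forall_det_ne_zero_of_linearEquiv {κ : Type*} [Fintype κ] [DecidableEq κ]
    {n k : ℕ} (hn : n ≠ 0) (hk : k ≤ n)
    (e : Matrix (Fin n) (Fin n) (ZMod 2) ≃ₗ[ZMod 2] (κ → ZMod 2)) :
    ∃ A : Fin k → Matrix (Fin n) (Fin n) (ZMod 2),
      (∀ c : Fin k → ZMod 2, c ≠ 0 → (∑ i, c i • A i).det ≠ 0) ∧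
      #{b | ∃ i, e (A i) b ≠ 0} ≤ 2 ^ k * n := by
  obtain ⟨A₀, hA₀⟩ := exists_forall_det_sum_smul_ne_zero hn hk
  let M (c : Fin k → ZMod 2) :
      Matrix (Fin n) (Fin n) (MvPolynomial (Fin k × κ) (ZMod 2)) := fun r s =>
    ∑ q : Fin k × κ, MvPolynomial.C (c q.1 * e.symm (Pi.single q.2 1) r s) * MvPolynomial.X q
  let P : MvPolynomial (Fin k × κ) (ZMod 2) :=
    ∏ c : Fin k → ZMod 2 with c ≠ 0, (M c).det
  have heval (v : Fin k × κ → ZMod 2) : MvPolynomial.eval v P =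
      ∏ c : Fin k → ZMod 2 with c ≠ 0, (∑ i, c i • e.symm fun b => v (i, b)).det := by
    simp only [P, MvPolynomial.eval_prod]
    refine prod_congr rfl fun c _ => ?_
    rw [RingHom.map_det]
    congr 1
    ext r s
    have hsymm (i : Fin k) : (e.symm fun b => v (i, b)) =
        ∑ b, v (i, b) • e.symm (Pi.single b 1) := by
      conv_lhs => rw [pi_eq_sum_univ' fun b => v (i, b)]
      simp [map_sum, map_smul]
    change MvPolynomial.eval v (M c r s) = _
    simp only [M, map_sum, map_mul,
      MvPolynomial.eval_C, MvPolynomial.eval_X, hsymm, Matrix.sum_apply, Matrix.smul_apply,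
      smul_eq_mul, Fintype.sum_prod_type, mul_sum]
    exact sum_congr rfl fun i _ => sum_congr rfl fun b _ => by ring
  have hdeg : P.totalDegree ≤ 2 ^ k * n := by
    refine (MvPolynomial.totalDegree_finsetProd _ _).trans ?_
    refine (sum_le_card_nsmul _ _ n fun c _ => totalDegree_det_le _ fun r s => ?_).trans ?_
    · refine MvPolynomial.totalDegree_finsetSum_le fun q _ => ?_
      refine (MvPolynomial.totalDegree_mul _ _).trans ?_
      rw [MvPolynomial.totalDegree_C, MvPolynomial.totalDegree_X]
    · rw [smul_eq_mul]
      refine Nat.mul_le_mul_right _ ((card_filter_le _ _).trans ?_)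
      simp
  obtain ⟨u, hu, hcard⟩ := MvPolynomial.exists_eval_ne_zero_card_support_le P
    (fun q => e (A₀ q.1) q.2) (by
      rw [heval, prod_ne_zero_iff]
      intro c hc
      simpa using hA₀ c (by simpa using hc))
  rw [heval, prod_ne_zero_iff] at hu
  refine ⟨fun i => e.symm fun b => u (i, b), fun c hc => hu c (by simpa using hc), ?_⟩
  refine le_trans ?_ (hcard.trans hdeg)
  refine (card_le_card fun b hb => ?_).trans
    (card_image_le (s := ({i | u i ≠ 0} : Finset (Fin k × κ))) (f := Prod.snd))
  simp only [mem_filter, mem_univ, true_and, LinearEquiv.apply_symm_apply] at hb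
  obtain ⟨i, hi⟩ := hb
  exact mem_image.mpr ⟨(i, b), by simpa using hi, rfl⟩

open Finset in
/-- A linear form over `ZMod 2` is nonzero on at most half of the space. -/
theorem LinearMap.two_mul_card_ne_zero_le {V : Type*} [AddCommGroup V] [Module (ZMod 2) V]
    [Fintype V] (f : V →ₗ[ZMod 2] ZMod 2) :
    2 * #{c | f c ≠ 0} ≤ Fintype.card V := by
  classical
  by_cases h : ∃ w, f w ≠ 0
  · obtain ⟨w, hw⟩ := h
    have hle : #{c | f c ≠ 0} ≤ #{c | ¬ f c ≠ 0} := by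
      refine card_le_card_of_injOn (· + w) (fun c hc => ?_) (add_left_injective w).injOn
      simp only [coe_filter, mem_univ, true_and, Set.mem_ofPred_eq, map_add] at hc ⊢
      generalize f c = a at hc
      generalize f w = b at hw
      revert a b
      decide
    have := card_filter_add_card_filter_not (s := (univ : Finset V)) (fun c => f c ≠ 0)
    rw [card_univ] at this
    omega
  · push Not at h
    simp [h]

open Finset in
/-- The Plotkin bound: if the nonzero words of the binary linear code given by the forms `f l` have
weight at least `d`, then at least `2 d (1 - 1 / |V|)` of its coordinates are not identically
zero. -/
theorem LinearMap.two_mul_card_sub_one_mul_le {V ι : Type*} [AddCommGroup V] [Module (ZMod 2) V]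
    [Fintype V] [DecidableEq V] [Fintype ι] (f : ι → V →ₗ[ZMod 2] ZMod 2) (S : Finset ι)
    (hS : ∀ l ∉ S, f l = 0) (d : ℕ) (hd : ∀ c ≠ 0, d ≤ #{l | f l c ≠ 0}) :
    2 * ((Fintype.card V - 1) * d) ≤ #S * Fintype.card V := by
  have h1 : (Fintype.card V - 1) * d ≤ ∑ c ∈ univ.erase (0 : V), #{l | f l c ≠ 0} := by
    have := card_nsmul_le_sum (univ.erase (0 : V)) (fun c => #{l | f l c ≠ 0}) d
      fun c hc => hd c (ne_of_mem_erase hc)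
    simpa [card_erase_of_mem] using this
  have h2 : ∑ c ∈ univ.erase (0 : V), #{l | f l c ≠ 0} ≤ ∑ l ∈ S, #{c | f l c ≠ 0} := by
    refine (sum_le_sum_of_subset (erase_subset _ _)).trans ?_
    have := sum_card_bipartiteAbove_eq_sum_card_bipartiteBelow (s := (univ : Finset V))
      (t := (univ : Finset ι)) (fun c l => f l c ≠ 0)
    simp only [bipartiteAbove, bipartiteBelow] at this
    rw [this]
    refine (sum_subset (subset_univ S) fun l _ hl => ?_).ge
    simp [hS l hl]
  have h3 : 2 * ∑ l ∈ S, #{c | f l c ≠ 0} ≤ #S * Fintype.card V := by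
    rw [mul_sum, ← smul_eq_mul (a := #S)]
    exact sum_le_card_nsmul _ _ _ fun l _ => two_mul_card_ne_zero_le (f l)
  omega

/-- If the forms `μ` separate points, some of them are the coordinates of a linear isomorphism. -/
theorem LinearMap.exists_injective_linearEquiv_apply {K V ι : Type*} [Field K] [AddCommGroup V]
    [Module K V] [FiniteDimensional K V] [Fintype ι] (μ : ι → V →ₗ[K] K)
    (hμ : ∀ x, (∀ l, μ l x = 0) → x = 0) :
    ∃ (a : Fin (Module.finrank K V) → ι) (e : V ≃ₗ[K] (Fin (Module.finrank K V) → K)),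
      Function.Injective a ∧ ∀ x b, e x b = μ (a b) x := by
  obtain ⟨κ, a, ha, hspan, hli⟩ := exists_linearIndependent' K μ
  have : Finite κ := Finite.of_injective a ha
  have := Fintype.ofFinite κ
  have hinj : Function.Injective (LinearMap.pi fun b => μ (a b)) := by
    rw [← LinearMap.ker_eq_bot, LinearMap.ker_eq_bot']
    refine fun x hx => hμ x fun l => ?_
    have hl : μ l ∈ Submodule.span K (Set.range (μ ∘ a)) :=
      hspan ▸ Submodule.subset_span ⟨l, rfl⟩
    refine Submodule.span_induction (p := fun g _ => g x = 0) ?_ (by simp) ?_ ?_ hl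
    · rintro _ ⟨b, rfl⟩
      exact congrFun hx b
    · intro g h _ _ hg hh
      simp [hg, hh]
    · intro c g _ hg
      simp [hg]
  have hcard : Fintype.card κ = Module.finrank K V := by
    refine le_antisymm ?_ ?_
    · have h := hli.fintype_card_le_finrank
      rwa [show Module.finrank K (V →ₗ[K] K) = Module.finrank K V from
        Subspace.dual_finrank_eq] at h
    · simpa using LinearMap.finrank_le_finrank_of_injective hinj
  let ε := (Fintype.equivFinOfCardEq hcard).symm
  have hinj' : Function.Injective (LinearMap.pi fun b => μ (a (ε b))) := fun x y hxy =>
    hinj (funext fun b => by simpa using congrFun hxy (ε.symm b))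
  refine ⟨a ∘ ε, LinearEquiv.ofInjectiveOfFinrankEq _ hinj' (by simp), ha.comp ε.injective,
    fun x b => rfl⟩

open Finset in
/-- The tradeoff bound for the length of a bilinear computation of the `n × n` matrix product over
`ZMod 2`, obtained from a code of dimension `k`. -/
theorem Matrix.three_mul_sq_le_of_bilinear_computation {n m k : ℕ} (hn : n ≠ 0) (hk : k ≤ n)
    (μ η : Fin m → (Matrix (Fin n) (Fin n) (ZMod 2) →ₗ[ZMod 2] ZMod 2))
    (α : Fin m → Fin n → Fin n → ZMod 2)
    (h : ∀ x y : Matrix (Fin n) (Fin n) (ZMod 2), ∀ i j : Fin n,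
      (x * y) i j = ∑ l : Fin m, α l i j * μ l x * η l y) :
    2 ^ k * (3 * n ^ 2) ≤ 2 ^ k * m + 2 ^ k * (2 ^ k * n) + 2 * n ^ 2 := by
  have hfin : Module.finrank (ZMod 2) (Matrix (Fin n) (Fin n) (ZMod 2)) = n ^ 2 := by
    simp [Module.finrank_matrix, sq]
  obtain ⟨a, e, ha, he⟩ := LinearMap.exists_injective_linearEquiv_apply μ fun x hx => by
    rw [← mul_one x]
    ext i j
    simp [h, hx]
  obtain ⟨A, hA, hcard⟩ := exists_forall_det_ne_zero_of_linearEquiv hn hk e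
  let f (l : Fin m) : (Fin k → ZMod 2) →ₗ[ZMod 2] ZMod 2 :=
    μ l ∘ₗ Fintype.linearCombination (ZMod 2) A
  let S : Finset (Fin m) := {l | ∃ i, μ l (A i) ≠ 0}
  have hplotkin := LinearMap.two_mul_card_sub_one_mul_le f S
    (fun l hl => by
      simp only [S, mem_filter, mem_univ, true_and, not_exists, not_not] at hl
      ext i
      simp [f, hl])
    (n ^ 2) fun c hc => by
      set x := ∑ i, c i • A i with hx
      have hf (l : Fin m) : f l c = μ l x := rfl
      have hinj : Function.Injective
          (LinearMap.pi fun l : ({l | f l c ≠ 0} : Finset (Fin m)) => η l) := by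
        rw [← LinearMap.ker_eq_bot, LinearMap.ker_eq_bot']
        intro y hy
        have hxy : x * y = 0 := by
          ext i j
          rw [h, Matrix.zero_apply]
          refine sum_eq_zero fun l _ => ?_
          by_cases hl : f l c = 0
          · simp [← hf, hl]
          · have := congrFun hy ⟨l, by simpa using hl⟩
            simp only [LinearMap.pi_apply, Pi.zero_apply] at this
            simp [this]
        have hu : IsUnit x := (Matrix.isUnit_iff_isUnit_det x).mpr (hA c hc).isUnit
        exact hu.mul_right_eq_zero.mp hxy
      have := LinearMap.finrank_le_finrank_of_injective hinj
      rwa [hfin, Module.finrank_fintype_fun_eq_card, Fintype.card_coe] at this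
  have hSm : #S + n ^ 2 ≤ m + 2 ^ k * n := by
    have h1 : #(({b | ¬ ∃ i, e (A i) b ≠ 0} : Finset _).map ⟨a, ha⟩) ≤ #Sᶜ := by
      refine card_le_card fun l hl => ?_
      simp only [mem_map, mem_filter, mem_univ, true_and, Function.Embedding.coeFn_mk] at hl
      obtain ⟨b, hb, rfl⟩ := hl
      simpa [S, he] using hb
    have h2 := card_filter_add_card_filter_not
      (s := (univ : Finset (Fin (Module.finrank (ZMod 2) (Matrix (Fin n) (Fin n) (ZMod 2))))))
      (fun b => ∃ i, e (A i) b ≠ 0)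
    have h3 := card_add_card_compl S
    rw [card_map] at h1
    replace h2 := h2.trans ((card_univ.trans (Fintype.card_fin _)).trans hfin)
    rw [Fintype.card_fin] at h3
    omega
  simp only [Fintype.card_fun, ZMod.card, Fintype.card_fin] at hplotkin
  have hpos : 1 ≤ 2 ^ k := Nat.one_le_two_pow
  zify [hpos] at hplotkin hSm ⊢
  have := mul_le_mul_of_nonneg_right hSm (by positivity : (0 : ℤ) ≤ 2 ^ k)
  linarith

/-- Every bilinear computation of n×n matrix product over GF(2)
has length m ≥ 3n² − C·n^(5/3) for some absolute constant C > 0. -/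
theorem bilinear_matrix_product_lower_bound_gf2 :
    ∃ C : ℝ, 0 < C ∧ ∀ n : ℕ, 1 ≤ n → ∀ m : ℕ,
      ∀ μ η : Fin m → (Matrix (Fin n) (Fin n) (ZMod 2) →ₗ[ZMod 2] ZMod 2),
      ∀ α : Fin m → Fin n → Fin n → ZMod 2,
      (∀ x y : Matrix (Fin n) (Fin n) (ZMod 2), ∀ i j : Fin n,
        (x * y) i j = ∑ k : Fin m, α k i j * μ k x * η k y) →
      (m : ℝ) ≥ 3 * (n : ℝ) ^ 2 - C * (n : ℝ) ^ ((5 : ℝ) / 3) := by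
  refine ⟨5, by norm_num, fun n hn m μ η α h => ?_⟩
  have hn0 : n ≠ 0 := by omega
  set k := Nat.log 4 n
  have hkn : k ≤ n := Nat.log_le_self 4 n
  have hlo : 4 ^ k ≤ n := Nat.pow_log_le_self 4 hn0
  have hhi : n < 4 ^ (k + 1) := Nat.lt_pow_succ_log_self (by norm_num) n
  have key := Matrix.three_mul_sq_le_of_bilinear_computation hn0 hkn μ η α h
  have h4 : 4 ^ k = 2 ^ k * 2 ^ k := by rw [← mul_pow]; norm_num
  rw [pow_succ] at hhi
  rw [h4] at hlo hhi
  have hn1 : (1 : ℝ) ≤ n := by exact_mod_cast hn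
  set r := √(n : ℝ)
  have hr : r * r = n := Real.mul_self_sqrt (by positivity)
  have hr0 : 0 ≤ r := Real.sqrt_nonneg _
  have hpow : n * r ≤ (n : ℝ) ^ ((5 : ℝ) / 3) := by
    have h32 : (n : ℝ) * r = (n : ℝ) ^ ((3 : ℝ) / 2) := by
      rw [show (3 : ℝ) / 2 = 1 + 1 / 2 by norm_num, Real.rpow_add (by positivity), Real.rpow_one,
        ← Real.sqrt_eq_rpow]
    rw [h32]
    exact Real.rpow_le_rpow_of_exponent_le hn1 (by norm_num)
  have hlo' : ((2 : ℝ) ^ k) * 2 ^ k ≤ r * r := by rw [hr]; exact_mod_cast hlo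
  have hhi' : r * r ≤ (2 * (2 : ℝ) ^ k) * (2 * 2 ^ k) := by
    rw [hr]
    have : (n : ℝ) < 2 ^ k * 2 ^ k * 4 := by exact_mod_cast hhi
    linarith
  have key' : (2 : ℝ) ^ k * (3 * n ^ 2) ≤ 2 ^ k * m + 2 ^ k * (2 ^ k * n) + 2 * n ^ 2 := by
    exact_mod_cast key
  have ht : (0 : ℝ) < 2 ^ k := by positivity
  generalize (2 : ℝ) ^ k = t at *
  have htr : t ≤ r := abs_le_of_sq_le_sq' (by nlinarith) hr0 |>.2
  have hrt : r ≤ 2 * t := abs_le_of_sq_le_sq' (by nlinarith) (by positivity) |>.2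
  have h1 : t * n ≤ r * n := by gcongr
  have h2 : (n : ℝ) ^ 2 ≤ 2 * t * (n * r) := by
    calc (n : ℝ) ^ 2 = r * (n * r) := by rw [← hr]; ring
      _ ≤ 2 * t * (n * r) := by gcongr
  have h3 : t * (3 * n ^ 2) ≤ t * (m + r * n + 4 * (n * r)) := by nlinarith
  have h4 := le_of_mul_le_mul_left h3 ht
  linarith
end

section
/- Let F be a field and let P be a polynomial of degree at most d in the variables x_1,…,x_n over F. If P is not identically zero as a function from F^n to F, then there exists an assignment ρ ∈ F^n such that at most d of the coordinates ρ_1,…,ρ_n are nonzero and P(ρ_1,…,ρ_n) ≠ 0. -/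
/-- The alternating sum, over the subsets `T` of `S`, of the values of `P` at the restrictions
of `x` to `T` vanishes as soon as `S` has more elements than the total degree of `P`. -/
theorem MvPolynomial.sum_powerset_neg_one_pow_mul_eval_piecewise_eq_zero {R σ : Type*}
    [CommRing R] [DecidableEq σ] (P : MvPolynomial σ R) (S : Finset σ)
    (hS : P.totalDegree < S.card) (x : σ → R) :
    ∑ T ∈ S.powerset, (-1) ^ T.card * MvPolynomial.eval (T.piecewise x 0) P = 0 := by
  simp only [MvPolynomial.eval_eq, Finset.mul_sum]
  rw [Finset.sum_comm]
  refine Finset.sum_eq_zero fun m hm => ?_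
  have hcard : m.support.card < S.card := by
    refine lt_of_le_of_lt ?_ ((MvPolynomial.le_totalDegree hm).trans_lt hS)
    rw [Finset.card_eq_sum_ones]
    exact Finset.sum_le_sum fun i hi => Nat.one_le_iff_ne_zero.2 (Finsupp.mem_support_iff.1 hi)
  obtain ⟨i, hiS, him⟩ := Finset.exists_mem_notMem_of_card_lt_card hcard
  rw [← Finset.insert_erase hiS, Finset.sum_powerset_insert (Finset.notMem_erase i S),
    ← Finset.sum_add_distrib]
  refine Finset.sum_eq_zero fun T hT => ?_
  have hiT : i ∉ T := fun h => Finset.notMem_erase i S (Finset.mem_powerset.1 hT h)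
  have hprod : ∏ j ∈ m.support, (insert i T).piecewise x 0 j ^ m j =
      ∏ j ∈ m.support, T.piecewise x 0 j ^ m j := by
    refine Finset.prod_congr rfl fun j hj => ?_
    rw [Finset.piecewise_insert_of_ne _ _ _ (ne_of_mem_of_not_mem hj him)]
  rw [hprod, Finset.card_insert_of_notMem hiT]
  ring

/-- If a polynomial P of total degree at most d over a field F is
not identically zero as a function on F^n, then it has a nonzero value at a
point with at most d nonzero coordinates. -/
theorem exists_sparse_nonvanishing_point {F : Type*} [Field F] {n d : ℕ}
    (P : MvPolynomial (Fin n) F) (hd : P.totalDegree ≤ d)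
    (hP : ∃ x : Fin n → F, MvPolynomial.eval x P ≠ 0) :
    ∃ ρ : Fin n → F, {i : Fin n | ρ i ≠ 0}.ncard ≤ d ∧
      MvPolynomial.eval ρ P ≠ 0 := by
  obtain ⟨x, hx⟩ := hP
  obtain ⟨S, hS, hmin⟩ := WellFounded.has_min (wellFounded_lt (α := Finset (Fin n)))
    {S | MvPolynomial.eval (S.piecewise x 0) P ≠ 0} ⟨Finset.univ, by simpa using hx⟩
  refine ⟨S.piecewise x 0, ?_, hS⟩
  have hsub : {i : Fin n | S.piecewise x 0 i ≠ 0} ⊆ (S : Set (Fin n)) := by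
    intro i hi
    by_contra h
    exact hi (Finset.piecewise_eq_of_notMem S x 0 h)
  refine (Set.ncard_le_ncard hsub).trans ?_
  rw [Set.ncard_coe_finset]
  by_contra! hlt
  have hsum := P.sum_powerset_neg_one_pow_mul_eval_piecewise_eq_zero S (hd.trans_lt hlt) x
  rw [Finset.sum_eq_single_of_mem S (Finset.mem_powerset_self S)] at hsum
  · exact hS (by simpa using hsum)
  · intro T hT hne
    have hzero : MvPolynomial.eval (T.piecewise x 0) P = 0 := by
      by_contra h
      exact hmin T h (lt_of_le_of_ne (Finset.mem_powerset.1 hT) hne)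
    rw [hzero, mul_zero]
end

section
/- Let F be a field, let μ_1,…,μ_{n²} be n² linearly independent linear forms on F^{n²} = M_n(F), and let P be a polynomial of degree at most d in k·n² variables over F, viewed as a polynomial P(x_1,…,x_k) in the entries of k matrices x_1,…,x_k of size n×n. If P is not identically zero as a function, then there exist k matrices a_1,…,a_k ∈ M_n(F) such that P(a_1,…,a_k) ≠ 0 and there exists a subset S ⊆ {1,…,n²} with |S| ≥ n² − d such that μ_i(a_j) = 0 for every i ∈ S and every j ∈ {1,…,k}. -/
open MvPolynomial in
/-- Substituting polynomials of degree at most one does not raise the total degree. -/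
theorem MvPolynomial.totalDegree_aeval_le_of_totalDegree_le_one {R σ τ : Type*} [CommSemiring R]
    (f : σ → MvPolynomial τ R) (hf : ∀ v, (f v).totalDegree ≤ 1) (P : MvPolynomial σ R) :
    (aeval f P).totalDegree ≤ P.totalDegree := by
  rw [aeval_def, eval₂_eq]
  refine totalDegree_finsetSum_le fun m hm => ?_
  refine (totalDegree_mul _ _).trans ?_
  rw [algebraMap_eq, totalDegree_C, zero_add]
  refine (totalDegree_finsetProd _ _).trans (le_trans ?_ (le_totalDegree hm))
  refine Finset.sum_le_sum fun v _ => (totalDegree_pow _ _).trans ?_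
  exact (Nat.mul_le_mul_left _ (hf v)).trans_eq (mul_one _)

open MvPolynomial in
/-- If a polynomial of degree less than `#T` vanishes at every proper partial sum of the
vectors `w i`, `i ∈ T`, then it vanishes at the full sum. -/
theorem MvPolynomial.eval_sum_eq_zero_of_forall_ssubset {F σ ι : Type*} [Field F]
    (P : MvPolynomial σ F) (T : Finset ι) (w : ι → σ → F) (hdeg : P.totalDegree < T.card)
    (h : ∀ S ⊂ T, eval (∑ i ∈ S, w i) P = 0) :
    eval (∑ i ∈ T, w i) P = 0 := by
  classical
  by_contra hc
  set c := eval (∑ i ∈ T, w i) P with hcdef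
  let Q : MvPolynomial T F := aeval (fun v => ∑ i : T, C (w i v) * X i) P
  have hQdeg : Q.totalDegree ≤ P.totalDegree := by
    refine totalDegree_aeval_le_of_totalDegree_le_one _ (fun v => ?_) P
    refine totalDegree_finsetSum_le fun i _ => (totalDegree_mul _ _).trans ?_
    simp
  have hQeval (x : T → F) : eval x Q = eval (∑ i : T, x i • w i) P := by
    simp only [Q, aeval_def, ← coe_eval₂Hom]
    rw [← RingHom.comp_apply, eval, eval]
    congr 1
    ext v <;> simp [mul_comm]
  let t : T →₀ ℕ := Finsupp.equivFunOnFinite.symm fun _ => 1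
  have ht : t.degree = T.card := by simp [t, Finsupp.degree_eq_sum]
  have hcoeff : Q.coeff t = 0 :=
    coeff_eq_zero_of_totalDegree_lt (by
      have : t.degree = ∑ i ∈ t.support, t i := rfl
      omega)
  have hmon : (monomial t c).totalDegree = t.degree := totalDegree_monomial t hc
  obtain ⟨x, hx, hne⟩ := combinatorial_nullstellensatz_exists_eval_nonzero
    (Q - monomial t c) t (by simp [hcoeff, hc])
    (by
      rw [sub_eq_add_neg, totalDegree_add_eq_right_of_totalDegree_lt, totalDegree_neg, hmon]
      rw [totalDegree_neg, hmon]; omega)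
    (fun _ => {0, 1}) (by simp [t])
  apply hne
  simp only [Finset.mem_insert, Finset.mem_singleton] at hx
  have hsum : ∑ i : T, x i • w i = ∑ i ∈ T with ∃ hi : i ∈ T, x ⟨i, hi⟩ = 1, w i := by
    rw [Finset.sum_filter, ← Finset.sum_coe_sort T]
    refine Finset.sum_congr rfl fun i _ => ?_
    rcases hx i with hi | hi <;> simp [hi]
  have hmeval : eval x (monomial t c) = c * ∏ i, x i := by
    simp [t, eval_monomial, Finsupp.prod_fintype]
  rw [map_sub, hQeval, hsum, hmeval, sub_eq_zero]
  by_cases hall : ∀ i, x i = 1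
  · rw [Finset.filter_true_of_mem fun i hi => ⟨hi, hall _⟩, ← hcdef]
    simp [hall]
  · push Not at hall
    obtain ⟨i, hi⟩ := hall
    rw [h _ (Finset.filter_ssubset.2 ⟨i, i.2, fun ⟨_, h1⟩ => hi h1⟩),
      Finset.prod_eq_zero (Finset.mem_univ i) ((hx i).resolve_right hi), mul_zero]

/-- A linearly independent family of `finrank F V` linear forms on `V` is a coordinate system. -/
theorem LinearIndependent.exists_linearEquiv_of_card_eq_finrank {F V ι : Type*} [Field F]
    [AddCommGroup V] [Module F V] [FiniteDimensional F V] [Fintype ι] {μ : ι → (V →ₗ[F] F)}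
    (hμ : LinearIndependent F μ) (hcard : Fintype.card ι = Module.finrank F V) :
    ∃ E : V ≃ₗ[F] (ι → F), ∀ v i, E v i = μ i v := by
  have hspan : Submodule.span F (Set.range μ) = ⊤ :=
    hμ.span_eq_top_of_card_eq_finrank' (hcard.trans Subspace.dual_finrank_eq.symm)
  have hinj : Function.Injective (LinearMap.pi μ) := by
    rw [← LinearMap.ker_eq_bot, LinearMap.ker_eq_bot']
    intro v hv
    refine (Module.forall_dual_apply_eq_zero_iff F v).1 fun φ => ?_
    have hφ : φ ∈ Submodule.span F (Set.range μ) := hspan ▸ Submodule.mem_top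
    have hle : Submodule.span F (Set.range μ) ≤ LinearMap.ker (Module.Dual.eval F V v) := by
      rw [Submodule.span_le]
      rintro _ ⟨i, rfl⟩
      exact congrFun hv i
    exact hle hφ
  exact ⟨LinearMap.linearEquivOfInjective _ hinj (by simp [hcard]), fun _ _ => rfl⟩


/-- Given n² linearly independent linear forms on M_n(F) and a
polynomial P of degree at most d in the entries of k matrices that is not
identically zero as a function, there are matrices a_1,…,a_k on which P is
nonzero and at least n² − d of the forms vanish on all the a_j. -/
theorem exists_matrices_nonvanishing_with_many_vanishing_forms
    {F : Type*} [Field F] {n k d : ℕ}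
    (μ : Fin (n ^ 2) → (Matrix (Fin n) (Fin n) F →ₗ[F] F))
    (hμ : LinearIndependent F μ)
    (P : MvPolynomial (Fin k × Fin n × Fin n) F)
    (hd : P.totalDegree ≤ d)
    (hP : ∃ a : Fin k → Matrix (Fin n) (Fin n) F,
      MvPolynomial.eval (fun v => a v.1 v.2.1 v.2.2) P ≠ 0) :
    ∃ a : Fin k → Matrix (Fin n) (Fin n) F,
      MvPolynomial.eval (fun v => a v.1 v.2.1 v.2.2) P ≠ 0 ∧
      ∃ S : Finset (Fin (n ^ 2)), (n : ℤ) ^ 2 - (d : ℤ) ≤ (S.card : ℤ) ∧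
        ∀ i ∈ S, ∀ j : Fin k, μ i (a j) = 0 := by
  classical
  obtain ⟨E, hE⟩ := hμ.exists_linearEquiv_of_card_eq_finrank
    (by simp [Module.finrank_matrix, sq])
  let Supported (T : Finset (Fin (n ^ 2))) : Prop :=
    ∃ a : Fin k → Matrix (Fin n) (Fin n) F,
      MvPolynomial.eval (fun v => a v.1 v.2.1 v.2.2) P ≠ 0 ∧ ∀ i ∉ T, ∀ j, μ i (a j) = 0
  obtain ⟨a₀, ha₀⟩ := hP
  obtain ⟨T, hT⟩ := exists_minimal_of_wellFoundedLT Supported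
    ⟨Finset.univ, a₀, ha₀, fun i hi => absurd (Finset.mem_univ i) hi⟩
  obtain ⟨⟨a, ha, haT⟩, hmin⟩ := hT
  refine ⟨a, ha, Tᶜ, ?_, fun i hi => haT i (Finset.mem_compl.1 hi)⟩
  let b (S : Finset (Fin (n ^ 2))) (j : Fin k) : Matrix (Fin n) (Fin n) F :=
    ∑ i ∈ S, E.symm (Pi.single i (μ i (a j)))
  have hb (S : Finset (Fin (n ^ 2))) (j : Fin k) (i : Fin (n ^ 2)) :
      μ i (b S j) = if i ∈ S then μ i (a j) else 0 := by
    rw [← hE]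
    simp [b, Finset.sum_apply, Pi.single_apply]
  have hbT : b T = a := by
    funext j
    refine E.injective (funext fun i => ?_)
    rw [hE, hE, hb]
    split_ifs with hi
    · rfl
    · exact (haT i hi j).symm
  have hsum (S : Finset (Fin (n ^ 2))) :
      (∑ i ∈ S, fun v : Fin k × Fin n × Fin n =>
        E.symm (Pi.single i (μ i (a v.1))) v.2.1 v.2.2) = fun v => b S v.1 v.2.1 v.2.2 := by
    funext v
    simp [b, Finset.sum_apply, Matrix.sum_apply]
  have hle : T.card ≤ d := by
    by_contra! hlt
    have := MvPolynomial.eval_sum_eq_zero_of_forall_ssubset P T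
      (fun i v => E.symm (Pi.single i (μ i (a v.1))) v.2.1 v.2.2) (hd.trans_lt hlt)
      fun S hS => by
        rw [hsum]
        by_contra hne
        exact hS.not_subset (hmin ⟨b S, hne, fun i hi j => by rw [hb, if_neg hi]⟩ hS.subset)
    rw [hsum, hbT] at this
    exact ha this
  have hcard := Finset.card_compl_add_card T
  rw [Fintype.card_fin] at hcard
  have : ((Tᶜ.card + T.card : ℕ) : ℤ) = (n : ℤ) ^ 2 := by rw [hcard]; push_cast; rfl
  push_cast at this
  omega
end

section
/- Let p be a prime and let v_1,…,v_k be k vectors in GF(p)^t with k > 2p. Then there exist indices i < j < l such that the number of coordinates on which v_i, v_j and v_l all take the same value is at least t/p² − 3t/(pk). -/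
open Finset

theorem six_mul_choose_three (n : ℕ) :
    6 * (n.choose 3 : ℝ) = n * (n - 1) * (n - 2) := by
  induction n with
  | zero => simp
  | succ n ih =>
    rw [Nat.choose_succ_succ' n 2, Nat.cast_add, Nat.cast_choose_two, mul_add, ih]
    push_cast
    ring

/-- The cubic `x (x - 1) (x - 2)` lies above its tangent line at `m ≥ 2` on the nonnegative
reals. -/
theorem tangent_le_cubic {x m : ℝ} (hx : 0 ≤ x) (hm : 2 ≤ m) :
    m * (m - 1) * (m - 2) + (3 * m ^ 2 - 6 * m + 2) * (x - m) ≤ x * (x - 1) * (x - 2) := by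
  have h : 0 ≤ (x - m) ^ 2 * (x + 2 * m - 3) := mul_nonneg (sq_nonneg _) (by linarith)
  linarith

theorem card_mul_cubic_average_le_sum {α : Type*} [Fintype α] [Nonempty α] (x : α → ℝ)
    (hx : ∀ a, 0 ≤ x a) {m : ℝ} (hm : 2 ≤ m) (hsum : ∑ a, x a = Fintype.card α * m) :
    Fintype.card α * (m * (m - 1) * (m - 2)) ≤ ∑ a, x a * (x a - 1) * (x a - 2) := by
  have h := Finset.sum_le_sum fun a (_ : a ∈ univ) => tangent_le_cubic (hx a) hm
  rw [Finset.sum_add_distrib, ← Finset.mul_sum univ (fun a => x a - m), Finset.sum_sub_distrib,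
    hsum] at h
  simpa using h

/-- Counting monochromatic triples of a colouring by colour. -/
theorem card_monochromatic_triples {ι α : Type*} [Fintype ι] [DecidableEq ι] [Fintype α]
    [DecidableEq α] (f : ι → α) :
    #{s ∈ powersetCard 3 (univ : Finset ι) | ∃ a, ∀ i ∈ s, f i = a} =
      ∑ a, (#{i | f i = a}).choose 3 := by
  have h : {s ∈ powersetCard 3 (univ : Finset ι) | ∃ a, ∀ i ∈ s, f i = a} =
      univ.biUnion fun a => powersetCard 3 {i | f i = a} := by
    ext s
    simp [mem_powersetCard, subset_iff, and_comm]
  rw [h, card_biUnion]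
  · simp
  · intro a _ b _ hab
    rw [Function.onFun, disjoint_left]
    intro s ha hb
    rw [mem_powersetCard] at ha hb
    obtain ⟨i, hi⟩ : s.Nonempty := card_pos.1 (by omega)
    exact hab ((mem_filter.1 (ha.1 hi)).2.symm.trans (mem_filter.1 (hb.1 hi)).2)

theorem agreement_density_le {p k : ℝ} (hp : 1 ≤ p) (hk : 2 * p + 1 ≤ k) :
    (1 / p ^ 2 - 3 / (p * k)) * (k * (k - 1) * (k - 2)) ≤
      p * (k / p * (k / p - 1) * (k / p - 2)) := by
  have hp0 : 0 < p := by linarith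
  have hk0 : 0 < k := by linarith
  have h : p * (k / p * (k / p - 1) * (k / p - 2)) -
      (1 / p ^ 2 - 3 / (p * k)) * (k * (k - 1) * (k - 2)) =
      (k * (3 * k + 2 * p ^ 2 - 9 * p - 2) + 6 * p) / p ^ 2 := by
    field_simp
    ring
  have h' : 0 ≤ 3 * k + 2 * p ^ 2 - 9 * p - 2 := by nlinarith
  have : 0 ≤ (k * (3 * k + 2 * p ^ 2 - 9 * p - 2) + 6 * p) / p ^ 2 := by positivity
  linarith

/-- The proportion of monochromatic triples in a colouring of `ι` with `α`. -/
theorem le_card_monochromatic_triples {ι α : Type*} [Fintype ι] [DecidableEq ι] [Fintype α]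
    [Nonempty α] [DecidableEq α] (h : 2 * Fintype.card α < Fintype.card ι) (f : ι → α) :
    (1 / (Fintype.card α : ℝ) ^ 2 - 3 / (Fintype.card α * Fintype.card ι)) *
        (Fintype.card ι).choose 3 ≤
      #{s ∈ powersetCard 3 (univ : Finset ι) | ∃ a, ∀ i ∈ s, f i = a} := by
  have hp : (1 : ℝ) ≤ Fintype.card α := by exact_mod_cast Fintype.card_pos (α := α)
  have hk : 2 * (Fintype.card α : ℝ) + 1 ≤ Fintype.card ι := by exact_mod_cast h
  have hm : (2 : ℝ) ≤ Fintype.card ι / Fintype.card α := by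
    rw [le_div_iff₀ (by linarith)]
    linarith
  have hsum : ∑ a, (#{i | f i = a} : ℝ) =
      Fintype.card α * (Fintype.card ι / Fintype.card α : ℝ) := by
    rw [mul_div_cancel₀ _ (by linarith)]
    exact_mod_cast (card_eq_sum_card_fiberwise (s := univ) (t := univ) (f := f)
      fun _ _ => by simp).symm
  have hcubic := card_mul_cubic_average_le_sum _ (fun a => Nat.cast_nonneg _) hm hsum
  simp_rw [← six_mul_choose_three] at hcubic
  rw [← mul_sum] at hcubic
  have hdensity := agreement_density_le hp hk
  rw [← six_mul_choose_three] at hdensity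
  rw [card_monochromatic_triples]
  push_cast
  linarith

theorem exists_three_subset_large_agreement {ι κ α : Type*} [Fintype ι] [DecidableEq ι]
    [Fintype κ] [Fintype α] [Nonempty α] [DecidableEq α]
    (h : 2 * Fintype.card α < Fintype.card ι) (v : ι → κ → α) :
    ∃ s : Finset ι, #s = 3 ∧
      (1 / (Fintype.card α : ℝ) ^ 2 - 3 / (Fintype.card α * Fintype.card ι)) * Fintype.card κ ≤
        #{c : κ | ∃ a, ∀ i ∈ s, v i c = a} := by
  have hp : 0 < Fintype.card α := Fintype.card_pos
  have hne : (powersetCard 3 (univ : Finset ι)).Nonempty :=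
    powersetCard_nonempty.2 (by rw [card_univ]; omega)
  have hcount := sum_card_bipartiteAbove_eq_sum_card_bipartiteBelow
    (s := powersetCard 3 (univ : Finset ι)) (t := (univ : Finset κ))
    fun s c => ∃ a, ∀ i ∈ s, v i c = a
  simp only [bipartiteAbove, bipartiteBelow] at hcount
  have hsum := sum_le_sum fun c (_ : c ∈ (univ : Finset κ)) =>
    le_card_monochromatic_triples h fun i => v i c
  rw [← Nat.cast_sum, ← hcount, Nat.cast_sum] at hsum
  refine (exists_le_of_sum_le hne (le_trans (le_of_eq ?_) hsum)).imp
    fun s hs => ⟨(mem_powersetCard.1 hs.1).2, hs.2⟩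
  simp only [sum_const, card_powersetCard, card_univ, nsmul_eq_mul]
  ring

/-- Among k > 2p vectors in GF(p)^t, three of them agree
(all take the same value) on at least t/p² − 3t/(pk) coordinates. -/
theorem exists_triple_with_large_agreement (p : ℕ) [Fact p.Prime] (t k : ℕ)
    (hk : 2 * p < k) (v : Fin k → Fin t → ZMod p) :
    ∃ i j l : Fin k, i < j ∧ j < l ∧
      ((Finset.univ.filter fun c => v i c = v j c ∧ v j c = v l c).card : ℝ) ≥
        (t : ℝ) / (p : ℝ) ^ 2 - 3 * (t : ℝ) / ((p : ℝ) * (k : ℝ)) := by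
  obtain ⟨s, hs, hle⟩ :=
    exists_three_subset_large_agreement (by simpa [ZMod.card] using hk) v
  simp only [ZMod.card, Fintype.card_fin] at hle
  let e := s.orderEmbOfFin hs
  refine ⟨e 0, e 1, e 2, e.strictMono (by decide), e.strictMono (by decide), ?_⟩
  calc (t : ℝ) / (p : ℝ) ^ 2 - 3 * (t : ℝ) / ((p : ℝ) * (k : ℝ))
      = (1 / (p : ℝ) ^ 2 - 3 / (p * k)) * t := by ring
    _ ≤ _ := hle
    _ ≤ _ := Nat.cast_le.2 (card_le_card fun c hc => ?_)
  simp only [mem_filter, mem_univ, true_and] at hc ⊢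
  obtain ⟨a, ha⟩ := hc
  have he (n : Fin 3) : v (e n) c = a := ha _ (s.orderEmbOfFin_mem hs n)
  simp only [he, and_self]
end

section
/- Let v_1,…,v_k be k vectors in {0,1}^t with k > 2, and suppose that for all i ≠ j the Hamming distance satisfies d_H(v_i, v_j) ≥ N. Then t ≥ 2N − 4N/(k+2). -/
/-- Among the ordered pairs of entries of a binary word of length `k`, at most half differ. -/
lemma two_mul_sum_ne_le_sq {k : ℕ} (x : Fin k → ZMod 2) :
    2 * ∑ i, ∑ j, (if x i ≠ x j then (1 : ℝ) else 0) ≤ (k : ℝ) ^ 2 := by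
  set s : Fin k → ℝ := fun i => if x i = 0 then 1 else -1 with hs
  have binary : ∀ a : ZMod 2, a = 0 ∨ a = 1 := by decide
  have key : ∀ i j, (if x i ≠ x j then (1 : ℝ) else 0) = (1 - s i * s j) / 2 := by
    intro i j
    rcases binary (x i) with hi | hi <;> rcases binary (x j) with hj | hj <;>
      norm_num [hs, hi, hj]
  have hsum : 2 * ∑ i, ∑ j, (if x i ≠ x j then (1 : ℝ) else 0)
      = (k : ℝ) ^ 2 - (∑ i, s i) ^ 2 := by
    simp_rw [key, ← Finset.sum_div, Finset.sum_sub_distrib, ← Finset.mul_sum, ← Finset.sum_mul]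
    simp
    ring
  nlinarith [sq_nonneg (∑ i, s i)]

/-- The Plotkin averaging bound for `k` binary words of length `t` at pairwise distance at
least `N`. -/
lemma plotkin_averaging_bound {t k N : ℕ} (v : Fin k → Fin t → ZMod 2)
    (hdist : ∀ i j : Fin k, i ≠ j →
      N ≤ (Finset.univ.filter fun c => v i c ≠ v j c).card) :
    2 * ((k : ℝ) * ((k : ℝ) - 1) * N) ≤ t * (k : ℝ) ^ 2 := by
  have lower : (k : ℝ) * ((k : ℝ) - 1) * N
      ≤ ∑ i, ∑ j, ∑ c, (if v i c ≠ v j c then (1 : ℝ) else 0) := by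
    calc (k : ℝ) * ((k : ℝ) - 1) * N
        = ∑ i : Fin k, ∑ j : Fin k, ((N : ℝ) - if i = j then (N : ℝ) else 0) := by
          simp
          ring
      _ ≤ _ := by
          refine Finset.sum_le_sum fun i _ => Finset.sum_le_sum fun j _ => ?_
          rw [Finset.sum_boole]
          by_cases h : i = j
          · simp [h]
          · simpa [h] using hdist i j h
  have swap : ∑ i, ∑ j, ∑ c, (if v i c ≠ v j c then (1 : ℝ) else 0)
      = ∑ c, ∑ i, ∑ j, (if v i c ≠ v j c then (1 : ℝ) else 0) := by
    rw [Finset.sum_comm (s := (Finset.univ : Finset (Fin t)))]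
    exact Finset.sum_congr rfl fun i _ => Finset.sum_comm
  calc 2 * ((k : ℝ) * ((k : ℝ) - 1) * N)
      ≤ 2 * ∑ c, ∑ i, ∑ j, (if v i c ≠ v j c then (1 : ℝ) else 0) := by
        rw [← swap]
        gcongr
    _ ≤ ∑ _c : Fin t, (k : ℝ) ^ 2 := by
        rw [Finset.mul_sum]
        exact Finset.sum_le_sum fun c _ => two_mul_sum_ne_le_sq fun i => v i c
    _ = t * (k : ℝ) ^ 2 := by simp

/-- If {0,1}^t contains k > 2 vectors with pairwise Hamming
distance at least N, then t ≥ 2N − 4N/(k+2). -/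
theorem length_lower_bound_of_pairwise_distance (t k N : ℕ) (hk : 2 < k)
    (v : Fin k → Fin t → ZMod 2)
    (hdist : ∀ i j : Fin k, i ≠ j →
      N ≤ (Finset.univ.filter fun c => v i c ≠ v j c).card) :
    (t : ℝ) ≥ 2 * (N : ℝ) - 4 * (N : ℝ) / ((k : ℝ) + 2) := by
  have hk2 : (2 : ℝ) < k := by exact_mod_cast hk
  have hN : (0 : ℝ) ≤ N := N.cast_nonneg
  have hplotkin : 2 * (((k : ℝ) - 1) * N) ≤ t * k := by
    refine le_of_mul_le_mul_right ?_ (by linarith : (0 : ℝ) < k)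
    linarith [plotkin_averaging_bound v hdist]
  have hpos : (0 : ℝ) < k + 2 := by linarith
  have hrw : 2 * (N : ℝ) - 4 * (N : ℝ) / ((k : ℝ) + 2) = 2 * N * k / (k + 2) := by
    field_simp
    ring
  rw [ge_iff_le, hrw, div_le_iff₀ hpos]
  refine le_of_mul_le_mul_right ?_ (by linarith : (0 : ℝ) < k)
  nlinarith [mul_le_mul_of_nonneg_right hplotkin hpos.le,
    mul_nonneg hN (by linarith : (0 : ℝ) ≤ k - 2)]
end

section
/- Let n, k be positive integers with k ≤ 2^n and let μ_1,…,μ_{n²} be n² linearly independent linear forms on M_n(GF(2)). Then there exist k matrices a_1,…,a_k ∈ M_n(GF(2)) such that a_i − a_j is invertible for every i ≠ j, and there exists a subset S ⊆ {1,…,n²} with |S| ≥ n² − C(k,2)·n such that μ_i(a_j) = 0 for every i ∈ S and every j ∈ {1,…,k}. -/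
open MvPolynomial in
/-- A polynomial over `ZMod 2` of total degree `d` that is nonzero at some point is nonzero at a
point with at most `d` nonzero coordinates. -/
theorem MvPolynomial.exists_eval_ne_zero_card_support_le_s9 {σ : Type*} [Fintype σ] [DecidableEq σ]
    (P : MvPolynomial σ (ZMod 2)) (x : σ → ZMod 2) (hx : eval x P ≠ 0) :
    ∃ y : σ → ZMod 2, eval y P ≠ 0 ∧
      (Finset.univ.filter fun i => y i ≠ 0).card ≤ P.totalDegree := by
  have eq_one : ∀ a : ZMod 2, a ≠ 0 → a = 1 := by decide
  obtain ⟨y, hy, hmin⟩ := Finset.exists_min_image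
    (Finset.univ.filter fun y : σ → ZMod 2 => eval y P ≠ 0)
    (fun y => (Finset.univ.filter fun i => y i ≠ 0).card) ⟨x, by simpa using hx⟩
  simp only [Finset.mem_filter, Finset.mem_univ, true_and] at hy hmin
  refine ⟨y, hy, ?_⟩
  by_contra! hlt
  set T := Finset.univ.filter fun i => y i ≠ 0 with hT
  have hdeg : (∏ i ∈ Tᶜ, (1 - X i : MvPolynomial σ (ZMod 2))).totalDegree ≤ Tᶜ.card := by
    refine (totalDegree_finsetProd _ _).trans ?_
    rw [Finset.card_eq_sum_ones]
    refine Finset.sum_le_sum fun i _ => (totalDegree_sub _ _).trans ?_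
    simp
  have hsum := sum_eval_eq_zero (P * ∏ i ∈ Tᶜ, (1 - X i)) (by
    have := totalDegree_mul P (∏ i ∈ Tᶜ, (1 - X i : MvPolynomial σ (ZMod 2)))
    have := T.card_add_card_compl
    rw [ZMod.card]
    omega)
  rw [Fintype.sum_eq_single y] at hsum
  · rw [map_mul, map_prod, Finset.prod_eq_one, mul_one] at hsum
    · exact hy hsum
    · intro i hi
      have : y i = 0 := by simpa [hT] using hi
      simp [this]
  · intro z hz
    rw [map_mul, map_prod]
    by_cases hzT : ∃ i ∈ Tᶜ, z i ≠ 0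
    · obtain ⟨i, hi, hzi⟩ := hzT
      rw [Finset.prod_eq_zero hi (by simp [eq_one _ hzi]), mul_zero]
    · push Not at hzT
      by_cases hPz : eval z P = 0
      · rw [hPz, zero_mul]
      have hsub : (Finset.univ.filter fun i => z i ≠ 0) ⊆ T := by
        intro i hi
        by_contra h
        exact (Finset.mem_filter.mp hi).2 (hzT i (Finset.mem_compl.mpr h))
      have heq := Finset.eq_of_subset_of_card_le hsub (hmin z hPz)
      refine absurd ?_ hz
      funext i
      have hi : z i ≠ 0 ↔ y i ≠ 0 := by
        simpa [hT] using Finset.ext_iff.mp heq i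
      by_cases h : y i = 0
      · rw [h]
        by_contra h'
        exact hi.mp h' h
      · rw [eq_one _ h, eq_one _ (hi.mpr h)]

open MvPolynomial in
theorem Matrix.totalDegree_det_le_s9 {m σ R : Type*} [Fintype m] [DecidableEq m] [CommRing R]
    (A : Matrix m m (MvPolynomial σ R)) (hA : ∀ i j, (A i j).totalDegree ≤ 1) :
    A.det.totalDegree ≤ Fintype.card m := by
  rw [Matrix.det_apply]
  refine totalDegree_finsetSum_le fun τ _ => ?_
  refine (totalDegree_smul_le _ _).trans ((totalDegree_finsetProd _ _).trans ?_)
  exact (Finset.sum_le_sum fun i _ => hA _ _).trans (by simp)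

/-- The regular representation of the field with `2 ^ n` elements provides `2 ^ n` matrices
with pairwise invertible differences. -/
theorem Matrix.exists_isUnit_sub_of_le_two_pow {n k : ℕ} (hn : n ≠ 0) (hk : k ≤ 2 ^ n) :
    ∃ a : Fin k → Matrix (Fin n) (Fin n) (ZMod 2), ∀ i j, i ≠ j → IsUnit (a i - a j) := by
  let b := Module.finBasisOfFinrankEq (ZMod 2) (GaloisField 2 n) (GaloisField.finrank 2 hn)
  have hcard : Nat.card (Fin k) ≤ Nat.card (GaloisField 2 n) := by
    rwa [GaloisField.card 2 n hn, Nat.card_fin]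
  obtain ⟨f⟩ : Nonempty (Fin k ↪ GaloisField 2 n) := by
    have := Fintype.ofFinite (GaloisField 2 n)
    refine Function.Embedding.nonempty_of_card_le ?_
    simpa only [Nat.card_eq_fintype_card] using hcard
  refine ⟨fun i => Algebra.leftMulMatrix b (f i), fun i j hij => ?_⟩
  rw [← map_sub]
  exact (sub_ne_zero.mpr (f.injective.ne hij)).isUnit.map _

/-- A linearly independent family of `finrank K V` linear forms is a coordinate system. -/
theorem LinearIndependent.exists_linearEquiv_forall_apply {K V ι : Type*} [Field K]
    [AddCommGroup V] [Module K V] [FiniteDimensional K V] [Fintype ι]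
    {μ : ι → V →ₗ[K] K} (hμ : LinearIndependent K μ)
    (hcard : Fintype.card ι = Module.finrank K V) :
    ∃ e : V ≃ₗ[K] (ι → K), ∀ v i, e v i = μ i v := by
  have hspan : Submodule.span K (Set.range μ) = (⊤ : Submodule K (Module.Dual K V)) :=
    hμ.span_eq_top_of_card_eq_finrank' (by rw [hcard]; exact Subspace.dual_finrank_eq.symm)
  have hinj : Function.Injective (LinearMap.pi μ) := by
    rw [injective_iff_map_eq_zero]
    intro v hv
    rw [← Module.forall_dual_apply_eq_zero_iff K]
    intro φ
    have hφ : φ ∈ Submodule.span K (Set.range μ) := hspan ▸ Submodule.mem_top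
    induction hφ using Submodule.span_induction with
    | mem φ h =>
      obtain ⟨i, rfl⟩ := h
      exact congrFun hv i
    | zero => rfl
    | add φ ψ _ _ h₁ h₂ => rw [LinearMap.add_apply, h₁, h₂, add_zero]
    | smul c φ _ h => rw [LinearMap.smul_apply, h, smul_zero]
  exact ⟨LinearEquiv.ofInjectiveOfFinrankEq (LinearMap.pi μ) hinj (by simp [hcard]),
    fun v i => rfl⟩


/-- For k ≤ 2^n and n² linearly independent linear forms on
M_n(GF(2)), there are k matrices with pairwise invertible differences on all of
which at least n² − C(k,2)·n of the forms vanish. -/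
theorem exists_matrices_invertible_differences_with_vanishing_forms_gf2
    (n k : ℕ) (hn : 1 ≤ n) (hk : 1 ≤ k) (hk2 : k ≤ 2 ^ n)
    (μ : Fin (n ^ 2) → (Matrix (Fin n) (Fin n) (ZMod 2) →ₗ[ZMod 2] ZMod 2))
    (hμ : LinearIndependent (ZMod 2) μ) :
    ∃ a : Fin k → Matrix (Fin n) (Fin n) (ZMod 2),
      (∀ i j : Fin k, i ≠ j → IsUnit (a i - a j)) ∧
      ∃ S : Finset (Fin (n ^ 2)),
        (n : ℤ) ^ 2 - (k.choose 2 : ℤ) * (n : ℤ) ≤ (S.card : ℤ) ∧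
        ∀ i ∈ S, ∀ j : Fin k, μ i (a j) = 0 := by
  classical
  obtain ⟨e, he⟩ := hμ.exists_linearEquiv_forall_apply (by
    simp [Module.finrank_matrix, sq])
  let E : Fin (n ^ 2) → Matrix (Fin n) (Fin n) (ZMod 2) := fun l => e.symm (Pi.single l 1)
  have hE : ∀ w : Fin (n ^ 2) → ZMod 2, e.symm w = ∑ l, w l • E l := fun w => by
    simp only [E, ← map_smul, ← map_sum]
    congr 1
    ext l
    simp [Finset.sum_apply, Pi.single_apply]
  let D : Fin k → Fin k → Matrix (Fin n) (Fin n) (MvPolynomial (Fin k × Fin (n ^ 2)) (ZMod 2)) :=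
    fun i j => .of fun r c => ∑ l, (MvPolynomial.X (i, l) - MvPolynomial.X (j, l)) *
      MvPolynomial.C (E l r c)
  let P : MvPolynomial (Fin k × Fin (n ^ 2)) (ZMod 2) := ∏ i, ∏ j ∈ Finset.Iio i, (D i j).det
  have hdeg : P.totalDegree ≤ k.choose 2 * n := by
    have hD : ∀ i j, (D i j).det.totalDegree ≤ n := fun i j => by
      refine (Matrix.totalDegree_det_le_s9 _ fun r c => ?_).trans_eq (Fintype.card_fin n)
      simp only [D, Matrix.of_apply]
      refine MvPolynomial.totalDegree_finsetSum_le fun l _ => ?_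
      refine (MvPolynomial.totalDegree_mul _ _).trans ?_
      rw [MvPolynomial.totalDegree_C, add_zero]
      refine (MvPolynomial.totalDegree_sub _ _).trans ?_
      simp
    calc P.totalDegree ≤ ∑ i : Fin k, ∑ j ∈ Finset.Iio i, n :=
          (MvPolynomial.totalDegree_finsetProd _ _).trans <| Finset.sum_le_sum fun i _ =>
            (MvPolynomial.totalDegree_finsetProd _ _).trans <| Finset.sum_le_sum fun j _ => hD i j
      _ = k.choose 2 * n := by
          simp only [Finset.sum_const, Fin.card_Iio, smul_eq_mul, ← Finset.sum_mul]
          rw [Fin.sum_univ_eq_sum_range (fun i => i), Finset.sum_range_id, Nat.choose_two_right]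
  have heval : ∀ x : Fin k × Fin (n ^ 2) → ZMod 2, MvPolynomial.eval x P =
      ∏ i, ∏ j ∈ Finset.Iio i,
        (e.symm (fun l => x (i, l)) - e.symm (fun l => x (j, l))).det := fun x => by
    simp only [P, map_prod]
    refine Finset.prod_congr rfl fun i _ => Finset.prod_congr rfl fun j _ => ?_
    rw [RingHom.map_det, ← map_sub, hE]
    congr 1
    ext r c
    simp [D, Matrix.sum_apply]
  obtain ⟨a₀, ha₀⟩ := Matrix.exists_isUnit_sub_of_le_two_pow (Nat.one_le_iff_ne_zero.mp hn) hk2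
  obtain ⟨y, hy, hcard⟩ := P.exists_eval_ne_zero_card_support_le_s9 (fun p => e (a₀ p.1) p.2) (by
    rw [heval]
    refine Finset.prod_ne_zero_iff.mpr fun i _ => Finset.prod_ne_zero_iff.mpr fun j hj => ?_
    have := ha₀ i j (Finset.mem_Iio.mp hj).ne'
    rw [Matrix.isUnit_iff_isUnit_det] at this
    simpa using this.ne_zero)
  let T := (Finset.univ.filter fun p => y p ≠ 0).image Prod.snd
  refine ⟨fun i => e.symm fun l => y (i, l), ?_, Tᶜ, ?_, ?_⟩
  · have key : ∀ i j : Fin k, j < i →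
        IsUnit (e.symm (fun l => y (i, l)) - e.symm (fun l => y (j, l))) := fun i j hij => by
      rw [heval] at hy
      rw [Matrix.isUnit_iff_isUnit_det]
      exact (Finset.prod_ne_zero_iff.mp (Finset.prod_ne_zero_iff.mp hy i (Finset.mem_univ i)) j
        (Finset.mem_Iio.mpr hij)).isUnit
    intro i j hij
    rcases hij.lt_or_gt with h | h
    · rw [← neg_sub]
      exact (key j i h).neg
    · exact key i j h
  · have hT : T.card ≤ k.choose 2 * n := Finset.card_image_le.trans (hcard.trans hdeg)
    have hc := T.card_add_card_compl
    rw [Fintype.card_fin] at hc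
    zify at hT hc
    linarith
  · intro l hl j
    rw [← he, LinearEquiv.apply_symm_apply]
    by_contra h
    exact Finset.mem_compl.mp hl (Finset.mem_image.mpr ⟨(j, l), by simpa using h, rfl⟩)
end

section
/- Let p be a prime and let n, k be positive integers with k ≤ p^n. Then there exist k matrices a_1,…,a_k ∈ M_n(GF(p)) such that a_i − a_j is an invertible matrix for every i ≠ j. -/
/-- For every prime p and k ≤ p^n there are k matrices in
M_n(GF(p)) such that the difference of any two of them is invertible. -/
theorem exists_matrices_with_invertible_differences
    (p : ℕ) [Fact p.Prime] (n k : ℕ) (hn : 1 ≤ n) (hk : 1 ≤ k) (hk2 : k ≤ p ^ n) :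
    ∃ a : Fin k → Matrix (Fin n) (Fin n) (ZMod p),
      ∀ i j : Fin k, i ≠ j → IsUnit (a i - a j) := by
  have hn0 : n ≠ 0 := Nat.one_le_iff_ne_zero.mp hn
  let b : Module.Basis (Fin n) (ZMod p) (GaloisField p n) :=
    Module.finBasisOfFinrankEq _ _ (GaloisField.finrank p hn0)
  let e : GaloisField p n ≃ Fin (p ^ n) := Finite.equivFinOfCardEq (GaloisField.card p n hn0)
  refine ⟨fun i => Algebra.leftMulMatrix b (e.symm (Fin.castLE hk2 i)), fun i j hij => ?_⟩
  rw [← map_sub]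
  refine (IsUnit.mk0 _ (sub_ne_zero.mpr fun h => hij ?_)).map _
  exact Fin.castLE_injective hk2 (e.symm.injective h)
end

section
/- Let μ_1,…,μ_m, η_1,…,η_m and α^(k)_{i,j} form a bilinear computation of n×n matrix product over GF(2) of length m. Then for every matrix x ∈ M_n(GF(2)), the number of indices k ∈ {1,…,m} with μ_k(x) ≠ 0 is at least n·rank(x). -/
/-- The matrices whose columns all lie in the column space of `x` span a space of dimension
`n * x.rank`, so a subspace containing every product `x * y` has at least this dimension. -/
theorem Matrix.mul_rank_le_finrank_of_forall_mul_mem {K : Type*} [Field K] {n : ℕ}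
    (x : Matrix (Fin n) (Fin n) K) (W : Submodule K (Matrix (Fin n) (Fin n) K))
    (hW : ∀ y, x * y ∈ W) : n * x.rank ≤ Module.finrank K W := by
  let f : (Fin n → LinearMap.range x.mulVecLin) →ₗ[K] Matrix (Fin n) (Fin n) K :=
    { toFun := fun g => Matrix.of fun i j => (g j : Fin n → K) i
      map_add' := fun _ _ => rfl
      map_smul' := fun _ _ => rfl }
  have hf : Function.Injective f := by
    intro g h hgh
    funext j
    apply Subtype.ext
    funext i
    exact congrFun (congrFun hgh i) j
  have hfW : LinearMap.range f ≤ W := by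
    rintro _ ⟨g, rfl⟩
    choose v hv using fun j => (g j).2
    have h : f g = x * Matrix.of fun i j => v j i := by
      ext i j
      exact (congrFun (hv j) i).symm
    rw [h]
    exact hW _
  calc n * x.rank = Module.finrank K (Fin n → LinearMap.range x.mulVecLin) := by
        simp [Module.finrank_pi_fintype, Matrix.rank]
    _ = Module.finrank K (LinearMap.range f) := (LinearMap.finrank_range_of_inj hf).symm
    _ ≤ Module.finrank K W := Submodule.finrank_mono hfW

/-- In a bilinear computation of n×n matrix product over GF(2),
for every matrix x the number of indices k with μ_k(x) ≠ 0 is at least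
n·rank(x). -/
theorem bilinear_computation_weight_lower_bound_gf2 (n m : ℕ)
    (μ η : Fin m → (Matrix (Fin n) (Fin n) (ZMod 2) →ₗ[ZMod 2] ZMod 2))
    (α : Fin m → Fin n → Fin n → ZMod 2)
    (hcomp : ∀ x y : Matrix (Fin n) (Fin n) (ZMod 2), ∀ i j : Fin n,
      (x * y) i j = ∑ k : Fin m, α k i j * μ k x * η k y) :
    ∀ x : Matrix (Fin n) (Fin n) (ZMod 2),
      n * x.rank ≤ (Finset.univ.filter fun k => μ k x ≠ 0).card := by
  intro x
  let A : Fin m → Matrix (Fin n) (Fin n) (ZMod 2) := fun k => Matrix.of (α k)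
  let S : Finset (Matrix (Fin n) (Fin n) (ZMod 2)) :=
    (Finset.univ.filter fun k => μ k x ≠ 0).image A
  refine (x.mul_rank_le_finrank_of_forall_mul_mem
    (Submodule.span (ZMod 2) (S : Set (Matrix (Fin n) (Fin n) (ZMod 2)))) fun y => ?_).trans
    ((finrank_span_finset_le_card S).trans Finset.card_image_le)
  have h : x * y = ∑ k, (μ k x * η k y) • A k := by
    ext i j
    rw [hcomp, Matrix.sum_apply]
    refine Finset.sum_congr rfl fun k _ => ?_
    simp only [A, Matrix.smul_apply, Matrix.of_apply, smul_eq_mul]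
    ring
  rw [h]
  refine Submodule.sum_mem _ fun k _ => ?_
  by_cases hk : μ k x = 0
  · simp [hk]
  · refine Submodule.smul_mem _ _ (Submodule.subset_span ?_)
    exact Finset.mem_coe.2 (Finset.mem_image_of_mem A (by simpa using hk))
end

section
/- Let μ_1,…,μ_m, η_1,…,η_m and α^(k)_{i,j} form a quadratic computation of n×n matrix product over GF(2) of length m, and for each k ∈ {1,…,m} define the linear form γ_k on M_n(GF(2)) by γ_k(z) = Σ_{i,j} α^(k)_{i,j} · z_{i,j}. Then for every matrix z ∈ M_n(GF(2)), the number of indices k ∈ {1,…,m} with γ_k(z) ≠ 0 is at least n·rank(z). -/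
open Matrix

/-- If `f` is surjective and `ker g ≤ ker f`, then the codomain of `f` has dimension at most that
of `g`. -/
theorem LinearMap.finrank_le_finrank_of_ker_le_ker {K V W U : Type*} [Field K]
    [AddCommGroup V] [Module K V] [FiniteDimensional K V] [AddCommGroup W] [Module K W]
    [AddCommGroup U] [Module K U] [FiniteDimensional K U]
    {f : V →ₗ[K] W} {g : V →ₗ[K] U} (hf : Function.Surjective f)
    (h : LinearMap.ker g ≤ LinearMap.ker f) :
    Module.finrank K W ≤ Module.finrank K U := by
  have hfr := f.finrank_range_add_finrank_ker
  have hgr := g.finrank_range_add_finrank_ker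
  rw [LinearMap.range_eq_top.mpr hf, finrank_top] at hfr
  have hker := Submodule.finrank_mono h
  have hrange := (LinearMap.range g).finrank_le
  omega

/-- If `g (x, y) = 0` forces `A * x = 0` and `y * B = 0`,
then the codomain of `g` has dimension at least `n * (rank A + rank B)`. -/
theorem Matrix.mul_rank_add_rank_le_finrank {K U n : Type*} [Field K] [Fintype n]
    [AddCommGroup U] [Module K U] [FiniteDimensional K U] (A B : Matrix n n K)
    (g : Matrix n n K × Matrix n n K →ₗ[K] U)
    (hg : ∀ x y, g (x, y) = 0 → A * x = 0 ∧ y * B = 0) :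
    Fintype.card n * (A.rank + B.rank) ≤ Module.finrank K U := by
  classical
  let p : Matrix n n K →ₗ[K] (n → LinearMap.range A.mulVecLin) :=
    (A.mulVecLin.rangeRestrict.compLeft n).comp
      (Matrix.transposeLinearEquiv n n K K).toLinearMap
  let q : Matrix n n K →ₗ[K] (n → LinearMap.range Bᵀ.mulVecLin) :=
    Bᵀ.mulVecLin.rangeRestrict.compLeft n
  have hp : Function.Surjective p :=
    A.mulVecLin.surjective_rangeRestrict.comp_left.comp
      (Matrix.transposeLinearEquiv n n K K).surjective
  have hq : Function.Surjective q := Bᵀ.mulVecLin.surjective_rangeRestrict.comp_left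
  have hf : Function.Surjective (p.prodMap q) := hp.prodMap hq
  have hker : LinearMap.ker g ≤ LinearMap.ker (p.prodMap q) := by
    rintro ⟨x, y⟩ hxy
    obtain ⟨hx, hy⟩ := hg x y hxy
    refine Prod.ext (funext fun j => Subtype.ext (funext fun i => ?_))
      (funext fun i => Subtype.ext (funext fun j => ?_))
    · exact congrFun (congrFun hx i) j
    · refine (congrFun (Matrix.mulVec_transpose B (y i)) j).trans ?_
      exact congrFun (congrFun hy i) j
  have h := LinearMap.finrank_le_finrank_of_ker_le_ker hf hker
  rw [Module.finrank_prod, Module.finrank_pi_fintype, Module.finrank_pi_fintype] at h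
  simp only [Finset.sum_const, Finset.card_univ, smul_eq_mul] at h
  change Fintype.card n * A.rank + Fintype.card n * Bᵀ.rank ≤ _ at h
  rwa [Matrix.rank_transpose, ← mul_add] at h

/-- In a quadratic computation of n×n matrix product over GF(2),
with γ_k(z) = Σ_{i,j} α^(k)_{i,j} z_{i,j}, for every matrix z the number of
indices k with γ_k(z) ≠ 0 is at least n·rank(z). -/
theorem quadratic_computation_gamma_weight_lower_bound_gf2 (n m : ℕ)
    (μ η : Fin m →
      (Matrix (Fin n) (Fin n) (ZMod 2) × Matrix (Fin n) (Fin n) (ZMod 2) →ₗ[ZMod 2] ZMod 2))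
    (α : Fin m → Fin n → Fin n → ZMod 2)
    (hcomp : ∀ x y : Matrix (Fin n) (Fin n) (ZMod 2), ∀ i j : Fin n,
      (x * y) i j = ∑ k : Fin m, α k i j * μ k (x, y) * η k (x, y)) :
    ∀ z : Matrix (Fin n) (Fin n) (ZMod 2),
      n * z.rank ≤
        (Finset.univ.filter fun k : Fin m =>
          (∑ i : Fin n, ∑ j : Fin n, α k i j * z i j) ≠ 0).card := by
  intro z
  set S := Finset.univ.filter fun k : Fin m =>
    (∑ i : Fin n, ∑ j : Fin n, α k i j * z i j) ≠ 0 with hS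
  have htrace : ∀ x y : Matrix (Fin n) (Fin n) (ZMod 2), (zᵀ * (x * y)).trace =
      ∑ k ∈ S, (∑ i, ∑ j, α k i j * z i j) * (μ k (x, y) * η k (x, y)) := by
    intro x y
    have hsupp : ∑ k ∈ S, (∑ i, ∑ j, α k i j * z i j) * (μ k (x, y) * η k (x, y)) =
        ∑ k, (∑ i, ∑ j, α k i j * z i j) * (μ k (x, y) * η k (x, y)) := by
      refine Finset.sum_subset (Finset.subset_univ S) fun k _ hk => ?_
      rw [hS, Finset.mem_filter_univ, not_not] at hk
      rw [hk, zero_mul]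
    rw [hsupp]
    have hentries : (zᵀ * (x * y)).trace = ∑ i, ∑ j, z i j * (x * y) i j := by
      rw [Finset.sum_comm]
      simp only [Matrix.trace, Matrix.diag_apply, Matrix.mul_apply (M := zᵀ),
        Matrix.transpose_apply]
    simp only [hentries, hcomp, Finset.mul_sum, Finset.sum_mul]
    simp_rw [Finset.sum_comm (s := Finset.univ (α := Fin n)) (t := Finset.univ (α := Fin m))]
    refine Finset.sum_congr rfl fun k _ => Finset.sum_congr rfl fun i _ =>
      Finset.sum_congr rfl fun j _ => ?_
    ring
  let g : Matrix (Fin n) (Fin n) (ZMod 2) × Matrix (Fin n) (Fin n) (ZMod 2) →ₗ[ZMod 2]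
      (S → ZMod 2) × (S → ZMod 2) :=
    (LinearMap.pi fun k : S => μ k).prod (LinearMap.pi fun k : S => η k)
  have hg : ∀ x y, g (x, y) = 0 → zᵀ * x = 0 ∧ y * zᵀ = 0 := by
    intro x y hxy
    have hμ : ∀ k ∈ S, μ k (x, y) = 0 := fun k hk =>
      congrFun (congrArg Prod.fst hxy) ⟨k, hk⟩
    have hη : ∀ k ∈ S, η k (x, y) = 0 := fun k hk =>
      congrFun (congrArg Prod.snd hxy) ⟨k, hk⟩
    have hshift : ∀ x' y', (zᵀ * ((x + x') * (y + y'))).trace = (zᵀ * (x' * y')).trace := by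
      intro x' y'
      rw [htrace, htrace]
      refine Finset.sum_congr rfl fun k hk => ?_
      rw [← Prod.mk_add_mk, map_add, map_add, hμ k hk, hη k hk, zero_add, zero_add]
    constructor
    · rw [Matrix.ext_iff_trace_mul_right]
      intro w
      have h := hshift 0 (w - y)
      rwa [add_zero, add_sub_cancel, zero_mul, mul_zero, ← mul_assoc, ← zero_mul w] at h
    · rw [Matrix.ext_iff_trace_mul_right]
      intro w
      have h := hshift (w - x) 0
      rwa [add_zero, add_sub_cancel, mul_zero, mul_zero, ← mul_assoc, Matrix.trace_mul_comm,
        ← mul_assoc, ← zero_mul w] at h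
  have h := Matrix.mul_rank_add_rank_le_finrank zᵀ zᵀ g hg
  rw [Module.finrank_prod, Module.finrank_fintype_fun_eq_card, Fintype.card_coe,
    Fintype.card_fin, Matrix.rank_transpose, mul_add] at h
  omega
end

section
/- For every prime p there exists a constant C > 0 such that the following holds for all n ≥ 1 and all m with n² ≤ m ≤ 10n². Let μ_1,…,μ_m be linear forms on M_n(GF(p)) such that μ_1,…,μ_{n²} are linearly independent and such that the map Γ(a) = (μ_1(a),…,μ_m(a)) satisfies weight(Γ(a)) ≥ n·rank(a) for every a ∈ M_n(GF(p)). Then there exists an invertible matrix c ∈ M_n(GF(p)) such that the number of indices i ∈ {1,…,m} with μ_i(c) = 0 is at least (1 − 1/p)·n² + m/p − C·n^(5/3), and moreover the number of indices i ∈ {1,…,n²} with μ_i(c) = 0 is at least n² − C·n^(5/3). -/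
namespace MvPolynomial

theorem totalDegree_bind₁_le {σ τ R : Type*} [CommSemiring R] {d : ℕ}
    (g : σ → MvPolynomial τ R) (hg : ∀ i, (g i).totalDegree ≤ d) (F : MvPolynomial σ R) :
    (bind₁ g F).totalDegree ≤ F.totalDegree * d := by
  rw [bind₁, aeval_def, eval₂_eq]
  refine totalDegree_finsetSum_le fun m hm => ?_
  refine (totalDegree_mul _ _).trans ?_
  rw [algebraMap_eq, totalDegree_C, zero_add]
  refine (totalDegree_finsetProd _ _).trans ?_
  calc ∑ i ∈ m.support, (g i ^ m i).totalDegree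
      ≤ ∑ i ∈ m.support, m i * d := Finset.sum_le_sum fun i _ =>
        (totalDegree_pow _ _).trans (Nat.mul_le_mul_left _ (hg i))
    _ = (m.sum fun _ e => e) * d := by rw [← Finset.sum_mul, Finsupp.sum]
    _ ≤ F.totalDegree * d := Nat.mul_le_mul_right _ (le_totalDegree hm)

theorem totalDegree_det_le {σ ι R : Type*} [CommRing R] [Fintype ι] [DecidableEq ι] {d : ℕ}
    (M : Matrix ι ι (MvPolynomial σ R)) (hM : ∀ i j, (M i j).totalDegree ≤ d) :
    M.det.totalDegree ≤ Fintype.card ι * d := by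
  rw [Matrix.det_apply]
  refine totalDegree_finsetSum_le fun s _ => ?_
  have h : (∏ i, M (s i) i).totalDegree ≤ Fintype.card ι * d := by
    refine (totalDegree_finsetProd _ _).trans ?_
    simpa using Finset.sum_le_card_nsmul Finset.univ (fun i => (M (s i) i).totalDegree) d
      fun i _ => hM _ _
  rcases Int.units_eq_one_or (Equiv.Perm.sign s) with hs | hs <;> simpa [hs] using h

/-- Over a finite field, a polynomial function that is not identically zero is nonzero at some point
with at most `F.totalDegree` nonzero coordinates. -/
theorem exists_sparse_eval_ne_zero {σ K : Type*} [Fintype σ] [Field K] [Fintype K] [DecidableEq K]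
    (F : MvPolynomial σ K) {x : σ → K} (hx : eval x F ≠ 0) :
    ∃ y : σ → K, eval y F ≠ 0 ∧
      (Finset.univ.filter fun i => y i ≠ 0).card ≤ F.totalDegree := by
  classical
  obtain ⟨y, hy, hmin⟩ := (Finset.univ.filter fun y : σ → K => eval y F ≠ 0).exists_min_image
    (fun y => (Finset.univ.filter fun i => y i ≠ 0).card) ⟨x, by simpa using hx⟩
  simp only [Finset.mem_filter, Finset.mem_univ, true_and] at hy hmin
  refine ⟨y, hy, ?_⟩
  by_contra! hlt
  set q := Fintype.card K
  have hq : 1 < q := Fintype.one_lt_card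
  let g : σ → MvPolynomial {i // y i ≠ 0} K := fun i =>
    if h : y i ≠ 0 then C (y i) * X ⟨i, h⟩ ^ (q - 1) else 0
  have hg : ∀ i, (g i).totalDegree ≤ q - 1 := by
    intro i
    by_cases h : y i ≠ 0
    · simp only [g, dif_pos h]
      refine (totalDegree_mul _ _).trans ?_
      rw [totalDegree_C, zero_add, totalDegree_X_pow]
    · simp only [g, dif_neg h, totalDegree_zero, zero_le]
  have hsum := sum_eval_eq_zero (bind₁ g F) (by
    refine (totalDegree_bind₁_le g hg F).trans_lt ?_
    rw [Fintype.card_subtype, mul_comm]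
    exact Nat.mul_lt_mul_of_pos_left hlt (by omega))
  have heval : ∀ z : {i // y i ≠ 0} → K, eval z (bind₁ g F) =
      if ∀ i, z i ≠ 0 then eval y F else 0 := by
    intro z
    have h1 : eval z (bind₁ g F) = eval (fun i => eval z (g i)) F := by
      change eval₂Hom (RingHom.id K) z (bind₁ g F) = _
      rw [eval₂Hom_bind₁]
      rfl
    rw [h1]
    split_ifs with hz
    · congr 2
      funext i
      by_cases h : y i ≠ 0
      · simp [g, h, q, FiniteField.pow_card_sub_one_eq_one _ (hz ⟨i, h⟩)]
      · simp only [g, dif_neg h, map_zero]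
        exact (not_not.1 h).symm
    · push Not at hz
      obtain ⟨i, hi⟩ := hz
      by_contra hne
      refine absurd (hmin _ hne) (not_le.2 (Finset.card_lt_card ?_))
      refine Finset.ssubset_iff_subset_ne.2 ⟨fun j hj => ?_, fun heq => ?_⟩
      · simp only [Finset.mem_filter, Finset.mem_univ, true_and] at hj ⊢
        intro h
        exact hj (by simp [g, h])
      · have hmem : i.1 ∈ Finset.univ.filter fun i => y i ≠ 0 := by simpa using i.2
        rw [← heq] at hmem
        have hq' : q - 1 ≠ 0 := by omega
        simp [g, i.2, hi, hq'] at hmem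
  simp only [heval] at hsum
  rw [← Finset.sum_filter, Finset.sum_const, nsmul_eq_mul, mul_eq_zero_iff_right hy] at hsum
  have hcard : (Finset.univ.filter fun z : {i // y i ≠ 0} → K => ∀ i, z i ≠ 0).card =
      (q - 1) ^ Fintype.card {i // y i ≠ 0} := by
    have : (Finset.univ.filter fun z : {i // y i ≠ 0} → K => ∀ i, z i ≠ 0) =
        Fintype.piFinset fun _ => Finset.univ.erase 0 := by
      ext z; simp
    rw [this, Fintype.card_piFinset]
    simp [q]
  have h0 : (((Finset.univ.filter fun z : {i // y i ≠ 0} → K => ∀ i, z i ≠ 0).card : ℕ) : K)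
      ≠ 0 := by
    rw [hcard, Nat.cast_pow, Nat.cast_sub hq.le]
    simp [q]
  exact h0 hsum

end MvPolynomial

/-- If the matrix space over a finite field contains `t` matrices with invertible differences, then
it contains such a family that is sparse with respect to any prescribed basis. -/
theorem exists_sparse_isUnit_sub {K ι κ η : Type*} [Field K] [Fintype K] [DecidableEq K]
    [Fintype ι] [DecidableEq ι] [Fintype κ] [Fintype η] [DecidableEq η]
    (b : Module.Basis κ K (Matrix ι ι K)) (T : η → Matrix ι ι K)
    (hT : ∀ i j, i ≠ j → IsUnit (T i - T j)) :
    ∃ A : η → Matrix ι ι K, (∀ i j, i ≠ j → IsUnit (A i - A j)) ∧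
      ∀ i j, (Finset.univ.filter fun k => b.repr (A i - A j) k ≠ 0).card ≤
        Fintype.card η ^ 2 * Fintype.card ι := by
  classical
  let P : η → Matrix ι ι (MvPolynomial (η × κ) K) := fun i =>
    Matrix.of fun r s => ∑ k, MvPolynomial.C (b k r s) * MvPolynomial.X (i, k)
  let F : MvPolynomial (η × κ) K := ∏ ij ∈ Finset.univ.offDiag, (P ij.1 - P ij.2).det
  have hP : ∀ (x : η × κ → K) i, (MvPolynomial.eval x).mapMatrix (P i) =
      b.equivFun.symm fun k => x (i, k) := by
    intro x i
    ext r s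
    simp [P, Module.Basis.equivFun_symm_apply, Matrix.sum_apply, mul_comm]
  have hF : ∀ x : η × κ → K, MvPolynomial.eval x F ≠ 0 ↔ ∀ i j, i ≠ j →
      IsUnit ((b.equivFun.symm fun k => x (i, k)) - b.equivFun.symm fun k => x (j, k)) := by
    intro x
    simp only [F, map_prod, RingHom.map_det, map_sub, hP, Finset.prod_ne_zero_iff,
      Finset.mem_offDiag, Finset.mem_univ, true_and, Prod.forall, Matrix.isUnit_iff_isUnit_det,
      isUnit_iff_ne_zero]
  have hdeg : F.totalDegree ≤ Fintype.card η ^ 2 * Fintype.card ι := by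
    refine (MvPolynomial.totalDegree_finsetProd _ _).trans ?_
    refine (Finset.sum_le_card_nsmul _ _ (Fintype.card ι) fun ij _ => ?_).trans ?_
    · have hdeg1 : ∀ i r s, (P i r s).totalDegree ≤ 1 := by
        intro i r s
        refine MvPolynomial.totalDegree_finsetSum_le fun k _ => ?_
        refine (MvPolynomial.totalDegree_mul _ _).trans ?_
        simp
      simpa using MvPolynomial.totalDegree_det_le (d := 1) (P ij.1 - P ij.2) fun r s =>
        (MvPolynomial.totalDegree_sub _ _).trans (max_le (hdeg1 _ _ _) (hdeg1 _ _ _))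
    · rw [smul_eq_mul, Finset.offDiag_card, Finset.card_univ, sq]
      exact Nat.mul_le_mul_right _ (Nat.sub_le _ _)
  have hx : MvPolynomial.eval (fun ik : η × κ => b.equivFun (T ik.1) ik.2) F ≠ 0 := by
    rw [hF]
    intro i j hij
    have h : ∀ i, (b.equivFun.symm fun k => b.equivFun (T i) k) = T i :=
      fun i => b.equivFun.symm_apply_apply (T i)
    simpa only [h] using hT i j hij
  obtain ⟨y, hy, hcard⟩ := MvPolynomial.exists_sparse_eval_ne_zero F hx
  refine ⟨fun i => b.equivFun.symm fun k => y (i, k), (hF y).1 hy, fun i j => ?_⟩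
  refine le_trans ?_ (hcard.trans hdeg)
  refine (Finset.card_le_card ?_).trans
    (Finset.card_image_le (s := Finset.univ.filter fun ik => y ik ≠ 0) (f := Prod.snd))
  intro k hk
  simp only [Finset.mem_filter, Finset.mem_univ, true_and, map_sub, Finsupp.sub_apply,
    ← Module.Basis.equivFun_apply, LinearEquiv.apply_symm_apply] at hk
  simp only [Finset.mem_image, Finset.mem_filter, Finset.mem_univ, true_and, Prod.exists,
    exists_eq_right]
  by_contra! h
  simp [h] at hk

theorem exists_pairwise_isUnit_sub (p : ℕ) [Fact p.Prime] {n t : ℕ} (hn : n ≠ 0)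
    (ht : t ≤ p ^ n) :
    ∃ T : Fin t → Matrix (Fin n) (Fin n) (ZMod p), ∀ i j, i ≠ j → IsUnit (T i - T j) := by
  let L := GaloisField p n
  let b : Module.Basis (Fin n) (ZMod p) L :=
    Module.finBasisOfFinrankEq (ZMod p) L (GaloisField.finrank p hn)
  have : Fintype L := Fintype.ofFinite L
  have hL : Fintype.card L = p ^ n := by
    rw [← Nat.card_eq_fintype_card]; exact GaloisField.card p n hn
  obtain ⟨f⟩ : Nonempty (Fin t ↪ L) :=
    Function.Embedding.nonempty_of_card_le (by simpa [hL] using ht)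
  refine ⟨fun i => Algebra.leftMulMatrix b (f i), fun i j hij => ?_⟩
  rw [← map_sub]
  exact (isUnit_iff_ne_zero.2 (sub_ne_zero.2 (f.injective.ne hij))).map _

theorem card_sq_le_card_mul_card_filter_eq {η K : Type*} [Fintype η] [Fintype K] [DecidableEq K]
    (v : η → K) :
    Fintype.card η ^ 2 ≤
      Fintype.card K * ∑ i, ∑ j, if v i = v j then 1 else 0 := by
  classical
  let f : K → ℕ := fun x => ∑ i, if v i = x then 1 else 0
  have h1 : ∑ x, f x = Fintype.card η := by
    simp only [f]
    rw [Finset.sum_comm]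
    simp
  have h2 : ∑ x, f x ^ 2 = ∑ i, ∑ j, if v i = v j then 1 else 0 := by
    simp only [f, sq, Finset.sum_mul_sum]
    rw [Finset.sum_comm]
    refine Finset.sum_congr rfl fun i _ => ?_
    rw [Finset.sum_comm]
    refine Finset.sum_congr rfl fun j _ => ?_
    simp [eq_comm]
  rw [← h1, ← h2]
  exact sq_sum_le_card_mul_sum_sq

/-- Among `t ≥ 2` points, some two distinct ones agree on at least a `1 / q - 1 / t` fraction of a
given finite family of functions with values in a set of size `q`. -/
theorem exists_ne_agree {η K α : Type*} [Fintype η] [Fintype K] [DecidableEq K]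
    [Nontrivial η] [Nonempty K] (S : Finset α) (v : α → η → K) :
    ∃ i j, i ≠ j ∧ (S.card : ℝ) * (1 / Fintype.card K - 1 / Fintype.card η) ≤
      (S.filter fun s => v s i = v s j).card := by
  classical
  by_contra! h
  set q : ℝ := (Fintype.card K : ℝ)
  set t : ℝ := (Fintype.card η : ℝ)
  set z : ℝ := (S.card : ℝ) * (1 / q - 1 / t)
  have hq : 0 < q := by simp only [q]; exact_mod_cast Fintype.card_pos
  have ht : 0 < t := by simp only [t]; exact_mod_cast Fintype.card_pos
  have hz : 0 ≤ z := by
    obtain ⟨i, j, hij⟩ := exists_pair_ne η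
    exact (Nat.cast_nonneg _).trans (h i j hij).le
  have hlow : (S.card : ℝ) * t ^ 2 ≤
      q * ∑ i, ∑ j, ((S.filter fun s => v s i = v s j).card : ℝ) := by
    have h1 : ∀ s ∈ S, Fintype.card η ^ 2 ≤
        Fintype.card K * ∑ i, ∑ j, if v s i = v s j then 1 else 0 :=
      fun s _ => card_sq_le_card_mul_card_filter_eq (v s)
    have h2 := Finset.card_nsmul_le_sum S _ _ h1
    rw [← Finset.mul_sum, Finset.sum_comm] at h2
    have h3 : ∑ i, ∑ s ∈ S, ∑ j, (if v s i = v s j then 1 else 0) =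
        ∑ i, ∑ j, (S.filter fun s => v s i = v s j).card := by
      refine Finset.sum_congr rfl fun i _ => ?_
      rw [Finset.sum_comm]
      simp only [Finset.card_filter]
    rw [h3, smul_eq_mul] at h2
    simp only [q, t]
    exact_mod_cast h2
  have hup : ∑ i, ∑ j, ((S.filter fun s => v s i = v s j).card : ℝ) <
      t * S.card + t ^ 2 * z := by
    have h1 : ∀ i, ∑ j, ((S.filter fun s => v s i = v s j).card : ℝ) < S.card + t * z := by
      intro i
      obtain ⟨j, hj⟩ := exists_ne i
      have : ∑ j, ((S.filter fun s => v s i = v s j).card : ℝ) <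
          ∑ j, ((if i = j then (S.card : ℝ) else 0) + z) := by
        refine Finset.sum_lt_sum (fun j _ => ?_) ⟨j, Finset.mem_univ _, ?_⟩
        · by_cases hij : i = j
          · simpa [hij] using hz
          · simpa [hij] using (h i j hij).le
        · simpa [hj.symm] using h i j hj.symm
      simpa [Finset.sum_add_distrib, t] using this
    have h2 := Finset.sum_lt_sum_of_nonempty Finset.univ_nonempty fun i _ => h1 i
    refine h2.trans_eq ?_
    simp only [Finset.sum_const, Finset.card_univ, nsmul_eq_mul, t]
    ring
  have hqz : q * (t * S.card + t ^ 2 * z) = S.card * t ^ 2 := by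
    simp only [z]
    field_simp
    ring
  have := mul_lt_mul_of_pos_left hup hq
  linarith

/-- Linearly independent functionals, as many as the dimension, are the coordinates of a basis. -/
theorem exists_basis_repr_eq_of_linearIndependent_dual {K V κ : Type*} [Field K] [AddCommGroup V]
    [Module K V] [FiniteDimensional K V] [Fintype κ] (f : κ → V →ₗ[K] K)
    (hf : LinearIndependent K f) (hcard : Fintype.card κ = Module.finrank K V) :
    ∃ b : Module.Basis κ K V, ∀ v k, b.repr v k = f k v := by
  have hspan : Submodule.span K (Set.range f) = ⊤ :=
    hf.span_eq_top_of_card_eq_finrank' (by rw [hcard]; exact Subspace.dual_finrank_eq.symm)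
  have hinj : Function.Injective (LinearMap.pi f) := by
    rw [← LinearMap.ker_eq_bot, LinearMap.ker_eq_bot']
    intro v hv
    refine (Module.forall_dual_apply_eq_zero_iff K v).1 fun φ => ?_
    have hφ : φ ∈ Submodule.span K (Set.range f) := hspan ▸ Submodule.mem_top
    induction hφ using Submodule.span_induction with
    | mem x hx =>
      obtain ⟨k, rfl⟩ := hx
      exact congrFun hv k
    | zero => rfl
    | add x y _ _ hx hy => simp [hx, hy]
    | smul a x _ hx => simp [hx]
  let e := LinearEquiv.ofInjectiveOfFinrankEq (LinearMap.pi f) hinj (by simp [hcard])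
  exact ⟨Module.Basis.ofEquivFun e, fun v k => rfl⟩

/-- If μ_1,…,μ_m are linear forms on M_n(GF(p)) whose first n²
forms are linearly independent and which form a "code" (weight(Γ(a)) ≥
n·rank(a)), then there is an invertible matrix c on which at least
(1 − 1/p)n² + m/p − C·n^(5/3) of all the forms vanish, with at least
n² − C·n^(5/3) of the vanishing forms among the first n². -/
theorem exists_invertible_matrix_with_many_vanishing_forms (p : ℕ) [Fact p.Prime] :
    ∃ C : ℝ, 0 < C ∧ ∀ n : ℕ, 1 ≤ n → ∀ m : ℕ, ∀ hm1 : n ^ 2 ≤ m, m ≤ 10 * n ^ 2 →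
      ∀ μ : Fin m → (Matrix (Fin n) (Fin n) (ZMod p) →ₗ[ZMod p] ZMod p),
      LinearIndependent (ZMod p) (fun i : Fin (n ^ 2) => μ (Fin.castLE hm1 i)) →
      (∀ a : Matrix (Fin n) (Fin n) (ZMod p),
        n * a.rank ≤ (Finset.univ.filter fun i => μ i a ≠ 0).card) →
      ∃ c : Matrix (Fin n) (Fin n) (ZMod p), IsUnit c ∧
        ((Finset.univ.filter fun i : Fin m => μ i c = 0).card : ℝ) ≥
          (1 - 1 / (p : ℝ)) * (n : ℝ) ^ 2 + (m : ℝ) / (p : ℝ)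
            - C * (n : ℝ) ^ ((5 : ℝ) / 3) ∧
        ((Finset.univ.filter fun i : Fin m => i.val < n ^ 2 ∧ μ i c = 0).card : ℝ) ≥
          (n : ℝ) ^ 2 - C * (n : ℝ) ^ ((5 : ℝ) / 3) := by
  have hp : p.Prime := Fact.out
  refine ⟨40, by norm_num, fun n hn m hm1 hm2 μ hμ _ => ?_⟩
  obtain ⟨b, hb⟩ := exists_basis_repr_eq_of_linearIndependent_dual _ hμ
    (by simp [Module.finrank_matrix, sq])
  set r : ℝ := (n : ℝ) ^ ((1 : ℝ) / 3)
  have hn1 : (1 : ℝ) ≤ n := by exact_mod_cast hn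
  have hn0 : (0 : ℝ) < n := by linarith
  have hr1 : 1 ≤ r := Real.one_le_rpow hn1 (by norm_num)
  have hrn : r ≤ n := by
    simpa only [Real.rpow_one] using
      Real.rpow_le_rpow_of_exponent_le hn1 (by norm_num : (1 : ℝ) / 3 ≤ 1)
  have hr3 : r ^ 3 = n := by
    rw [← Real.rpow_natCast, ← Real.rpow_mul hn0.le]; norm_num
  have hr5 : (n : ℝ) ^ ((5 : ℝ) / 3) = r ^ 5 := by
    rw [← Real.rpow_natCast, ← Real.rpow_mul hn0.le]; norm_num
  set t : ℕ := ⌈r⌉₊ + 1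
  have ht_low : r ≤ t := by
    have := Nat.le_ceil r
    push_cast [t]; linarith
  have ht_up : (t : ℝ) ≤ 3 * r := by
    have := Nat.ceil_lt_add_one (zero_le_one.trans hr1)
    push_cast [t]; linarith
  have ht_pow : t ≤ p ^ n := by
    have h1 : ⌈r⌉₊ ≤ n := Nat.ceil_le.2 hrn
    have h2 : n < p ^ n := Nat.lt_pow_self hp.one_lt
    omega
  have ht2 : 2 ≤ t := by
    have : 0 < ⌈r⌉₊ := Nat.ceil_pos.2 (by linarith)
    omega
  have : Nontrivial (Fin t) := Fin.nontrivial_iff_two_le.2 ht2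
  obtain ⟨T, hT⟩ := exists_pairwise_isUnit_sub p (by omega) ht_pow
  obtain ⟨A, hA, hsparse⟩ := exists_sparse_isUnit_sub b T hT
  obtain ⟨i, j, hij, hagree⟩ := exists_ne_agree
    (Finset.univ.filter fun k : Fin m => ¬ k.val < n ^ 2) fun k i => μ k (A i)
  refine ⟨A i - A j, hA i j hij, ?_⟩
  have hlt : (Finset.univ.filter fun k : Fin m => k.val < n ^ 2) =
      Finset.univ.map (Fin.castLEEmb hm1) := by
    ext k
    simp only [Finset.mem_filter, Finset.mem_univ, true_and, Finset.mem_map, Fin.castLEEmb_apply]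
    exact ⟨fun h => ⟨⟨k, h⟩, rfl⟩, by rintro ⟨l, rfl⟩; exact l.2⟩
  have hrest : ((Finset.univ.filter fun k : Fin m => ¬ k.val < n ^ 2).card : ℝ) = m - n ^ 2 := by
    have h := Finset.card_filter_add_card_filter_not
      (s := (Finset.univ : Finset (Fin m))) (fun k : Fin m => k.val < n ^ 2)
    rw [hlt, Finset.card_map, Finset.card_univ, Finset.card_univ, Fintype.card_fin,
      Fintype.card_fin] at h
    have h' : (n : ℝ) ^ 2 + ((Finset.univ.filter fun k : Fin m => ¬ k.val < n ^ 2).card : ℝ) = m :=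
      by exact_mod_cast h
    linarith
  have hfirst : (n : ℝ) ^ 2 - 9 * r ^ 5 ≤
      ((Finset.univ.filter fun k : Fin m => k.val < n ^ 2 ∧ μ k (A i - A j) = 0).card : ℝ) := by
    have h1 := hsparse i j
    simp only [hb, Fintype.card_fin] at h1
    have h2 := Finset.card_filter_add_card_filter_not
      (s := (Finset.univ : Finset (Fin (n ^ 2)))) (fun k => μ (Fin.castLE hm1 k) (A i - A j) = 0)
    rw [Finset.card_univ, Fintype.card_fin] at h2
    have h3 : (Finset.univ.filter fun k : Fin m => k.val < n ^ 2 ∧ μ k (A i - A j) = 0).card =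
        (Finset.univ.filter fun k => μ (Fin.castLE hm1 k) (A i - A j) = 0).card := by
      rw [← Finset.filter_filter, hlt, Finset.filter_map, Finset.card_map]
      rfl
    rw [h3]
    have h4 : (n : ℝ) ^ 2 ≤
        ((Finset.univ.filter fun k => μ (Fin.castLE hm1 k) (A i - A j) = 0).card : ℝ)
          + t ^ 2 * n := by
      exact_mod_cast h2.symm.le.trans (Nat.add_le_add_left h1 _)
    have h5 : (t : ℝ) ^ 2 * n ≤ 9 * r ^ 5 := by
      calc (t : ℝ) ^ 2 * n ≤ (3 * r) ^ 2 * n := by gcongr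
        _ = 9 * r ^ 5 := by rw [← hr3]; ring
    linarith
  have hr5_nonneg : 0 ≤ r ^ 5 := by positivity
  rw [hr5]
  refine ⟨?_, by linarith⟩
  have hsplit := Finset.card_filter_add_card_filter_not
    (s := Finset.univ.filter fun k : Fin m => μ k (A i - A j) = 0) (fun k => k.val < n ^ 2)
  simp only [Finset.filter_filter] at hsplit hagree
  simp only [and_comm (b := _ < n ^ 2), and_comm (b := ¬ _ < n ^ 2)] at hsplit
  have hsplit' : ((Finset.univ.filter fun k : Fin m => μ k (A i - A j) = 0).card : ℝ) =
      (Finset.univ.filter fun k : Fin m => k.val < n ^ 2 ∧ μ k (A i - A j) = 0).card +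
      (Finset.univ.filter fun k : Fin m => ¬ k.val < n ^ 2 ∧ μ k (A i - A j) = 0).card := by
    exact_mod_cast hsplit.symm
  simp only [hrest, ZMod.card, Fintype.card_fin, ← sub_eq_zero (b := μ _ (A j)), ← map_sub]
    at hagree
  have herr : ((m : ℝ) - n ^ 2) * (1 / t) ≤ 10 * r ^ 5 := by
    have hm : (m : ℝ) ≤ 10 * n ^ 2 := by exact_mod_cast hm2
    rw [mul_one_div, div_le_iff₀ (by linarith)]
    calc (m : ℝ) - n ^ 2 ≤ 10 * n ^ 2 := by nlinarith
      _ = 10 * r ^ 5 * r := by rw [← hr3]; ring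
      _ ≤ 10 * r ^ 5 * t := by gcongr
  rw [hsplit']
  have hexp : (1 - 1 / (p : ℝ)) * (n : ℝ) ^ 2 + (m : ℝ) / p =
      n ^ 2 + ((m : ℝ) - n ^ 2) * (1 / p) := by ring
  rw [hexp]
  linarith [mul_sub ((m : ℝ) - n ^ 2) (1 / p) (1 / t)]
end
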